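/- There is an absolute constant c such that for every graph H that is the disjoint union of r cycles, each of length at most ℓ, every graph of treewidth at least c·|V(H)|·log₂(r+1) + c·r·log₂ r·log₂ ℓ contains H as a minor. -/

import Mathlib

open SimpleGraph
variable {V : Type}

/-- `G` has a tree decomposition of width at most `w`. -/
def HasTreeDecompWidth (G : SimpleGraph V) (w : ℕ) : Prop :=
  ∃ (ι : Type) (T : SimpleGraph ι) (bag : ι → Set V),
    T.IsTree ∧
    (∀ v, ∃ i, v ∈ bag i) ∧
    (∀ u v, G.Adj u v → ∃ i, u ∈ bag i ∧ v ∈ bag i) ∧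
    (∀ v, (T.induce {i | v ∈ bag i}).Connected) ∧
    (∀ i, (bag i).Finite ∧ (bag i).ncard ≤ w + 1)

/-- The treewidth of `G`. -/
noncomputable def treewidth (G : SimpleGraph V) : ℕ := sInf {w | HasTreeDecompWidth G w}

/-- `H` is a minor of `G`, via branch sets. -/
def IsMinor {W : Type*} (H : SimpleGraph W) (G : SimpleGraph V) : Prop :=
  ∃ φ : W → Set V, (∀ w, (φ w).Nonempty ∧ (G.induce (φ w)).Connected) ∧
    (∀ w w', w ≠ w' → Disjoint (φ w) (φ w')) ∧
    (∀ w w', H.Adj w w' → ∃ u ∈ φ w, ∃ v ∈ φ w', G.Adj u v)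

/-- `H` is the disjoint union of `r` cycles, each of length at most `ℓ`. -/
def IsDisjointUnionOfCycles {W : Type*} (H : SimpleGraph W) (r ℓ : ℕ) : Prop :=
  ∃ f : Fin r → Σ v, H.Walk v v,
    (∀ i, (f i).2.IsCycle ∧ (f i).2.length ≤ ℓ) ∧
    (∀ i j, i ≠ j → ∀ x ∈ (f i).2.support, x ∉ (f j).2.support) ∧
    (∀ w : W, ∃ i, w ∈ (f i).2.support) ∧
    (∀ e ∈ H.edgeSet, ∃ i, e ∈ (f i).2.edges)

open Classical in
/-- Rooted tree decompositions of `G[A]` with bags of size at most `w` and root bag `B`. -/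
def TD (G : SimpleGraph V) (w : ℕ) (A B : Finset V) : Prop :=
  ∃ (ι : Type) (p : ι → ι) (d : ι → ℕ) (root : ι) (bag : ι → Finset V),
    (∀ i, i ≠ root → d (p i) < d i) ∧ bag root = B ∧ (∀ i, bag i ⊆ A) ∧
    (∀ v ∈ A, ∃ i, v ∈ bag i) ∧
    (∀ u ∈ A, ∀ v ∈ A, G.Adj u v → ∃ i, u ∈ bag i ∧ v ∈ bag i) ∧
    (∀ v ∈ A, ∃ t, v ∈ bag t ∧ ∀ i, v ∈ bag i → i ≠ t → i ≠ root ∧ v ∈ bag (p i)) ∧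
    ∀ i, (bag i).card ≤ w

/-- The graph of a parent function. -/
def parentGraph {ι : Type} (p : ι → ι) (root : ι) : SimpleGraph ι :=
  SimpleGraph.fromRel (fun i j => i ≠ root ∧ j = p i)

lemma parentGraph_adj {ι : Type} {p : ι → ι} {root : ι} {d : ι → ℕ}
    (hd : ∀ i, i ≠ root → d (p i) < d i) {i : ι} (hi : i ≠ root) :
    (parentGraph p root).Adj i (p i) := by
  refine ⟨?_, Or.inl ⟨hi, rfl⟩⟩
  intro h
  have := hd i hi
  rw [← h] at this
  exact lt_irrefl _ this

lemma parentGraph_isTree {ι : Type} {p : ι → ι} {root : ι} {d : ι → ℕ}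
    (hd : ∀ i, i ≠ root → d (p i) < d i) : (parentGraph p root).IsTree := by
  have hreach : ∀ n i, d i ≤ n → (parentGraph p root).Reachable i root := by
    intro n
    induction n with
    | zero =>
      intro i hi
      by_cases h : i = root
      · rw [h]
      · have := hd i h; omega
    | succ n ih =>
      intro i hi
      by_cases h : i = root
      · rw [h]
      · have := hd i h
        exact (parentGraph_adj hd h).reachable.trans (ih _ (by omega))
  refine ⟨?_, ?_⟩
  · have : Nonempty ι := ⟨root⟩
    exact ⟨fun i j => (hreach _ i le_rfl).trans (hreach _ j le_rfl).symm⟩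
  · classical
    intro v c hc
    obtain ⟨u, hu, hmax⟩ := (c.support.toFinset).exists_max_image d ⟨v, by simp⟩
    have hu' : u ∈ c.support := by simpa using hu
    have hc' := hc.rotate hu'
    set c' := c.rotate u hu' with hc'def
    have hmax' : ∀ x ∈ c'.support, d x ≤ d u := by
      intro x hx
      refine hmax x ?_
      have := (SimpleGraph.Walk.mem_support_rotate_iff c u hu').1 hx
      simpa using this
    have hnn : ¬ c'.Nil := hc'.not_nil
    have key : ∀ x, (parentGraph p root).Adj u x → x ∈ c'.support → x = p u := by
      intro x hx hxs
      rcases hx with ⟨hne, h | h⟩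
      · exact h.2
      · have := hd x h.1
        rw [← h.2] at this
        exact absurd (hmax' x hxs) (by omega)
    have h1 := key _ (c'.adj_snd hnn) (c'.getVert_mem_support 1)
    have h2 := key _ (c'.adj_penultimate hnn).symm (c'.getVert_mem_support _)
    exact hc'.snd_ne_penultimate (h1.trans h2.symm)

lemma TD.hasTreeDecompWidth [Fintype V] {G : SimpleGraph V} {w : ℕ} {B : Finset V}
    (h : TD G (w + 1) Finset.univ B) : HasTreeDecompWidth G w := by
  obtain ⟨ι, p, d, root, bag, hd, -, -, hcov, hedge, hconn, hw⟩ := h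
  refine ⟨ι, parentGraph p root, fun i => (bag i : Set V), parentGraph_isTree hd, ?_, ?_, ?_, ?_⟩
  · intro v; simpa using hcov v (Finset.mem_univ _)
  · intro u v huv; simpa using hedge u (Finset.mem_univ _) v (Finset.mem_univ _) huv
  · intro v
    obtain ⟨t, ht, hti⟩ := hconn v (Finset.mem_univ _)
    have hreach : ∀ n i (hi : v ∈ bag i), d i ≤ n →
        ((parentGraph p root).induce {i | v ∈ (bag i : Set V)}).Reachable ⟨i, hi⟩ ⟨t, ht⟩ := by
      intro n
      induction n with
      | zero =>
        intro i hi hdi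
        by_cases h : i = t
        · subst h; rfl
        · have := hd i (hti i hi h).1; omega
      | succ n ih =>
        intro i hi hdi
        by_cases h : i = t
        · subst h; rfl
        · have h1 := hti i hi h
          have h2 := hd i h1.1
          refine SimpleGraph.Reachable.trans (SimpleGraph.Adj.reachable ?_) (ih (p i) h1.2 (by omega))
          exact parentGraph_adj hd h1.1
    have : Nonempty ({i | v ∈ (bag i : Set V)} : Set ι) := ⟨⟨t, ht⟩⟩
    exact ⟨fun i j => (hreach _ i.1 i.2 le_rfl).trans (hreach _ j.1 j.2 le_rfl).symm⟩
  · intro i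
    refine ⟨(bag i).finite_toSet, ?_⟩
    rw [Set.ncard_coe_finset]
    exact hw i

lemma TD.single (G : SimpleGraph V) {w : ℕ} {A : Finset V} (h : A.card ≤ w) : TD G w A A :=
  ⟨Unit, id, fun _ => 0, (), fun _ => A, by simp, rfl, fun _ => subset_rfl,
    fun v hv => ⟨(), hv⟩, fun u hu v hv _ => ⟨(), hu, hv⟩,
    fun v hv => ⟨(), hv, fun i _ hi => absurd rfl hi⟩, fun _ => h⟩

lemma TD.mono {G : SimpleGraph V} {w w' : ℕ} {A B : Finset V} (h : TD G w A B) (hw : w ≤ w') :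
    TD G w' A B := by
  obtain ⟨ι, p, d, root, bag, h1, h2, h3, h4, h5, h6, h7⟩ := h
  exact ⟨ι, p, d, root, bag, h1, h2, h3, h4, h5, h6, fun i => (h7 i).trans hw⟩

lemma TD.subset {G : SimpleGraph V} {w : ℕ} {A B : Finset V} (h : TD G w A B) : B ⊆ A := by
  obtain ⟨ι, p, d, root, bag, h1, h2, h3, h4, h5, h6, h7⟩ := h
  rw [← h2]; exact h3 _

lemma TD.card {G : SimpleGraph V} {w : ℕ} {A B : Finset V} (h : TD G w A B) : B.card ≤ w := by
  obtain ⟨ι, p, d, root, bag, h1, h2, h3, h4, h5, h6, h7⟩ := h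
  rw [← h2]; exact h7 _

open Classical in
lemma TD.glue {G : SimpleGraph V} {w : ℕ} {A₁ B₁ A₂ B₂ : Finset V}
    (h₁ : TD G w A₁ B₁) (h₂ : TD G w A₂ B₂)
    (hinter : ∀ v, v ∈ A₁ → v ∈ A₂ → v ∈ B₁ ∧ v ∈ B₂)
    (hadj : ∀ u v, u ∈ A₁ → u ∉ A₂ → v ∈ A₂ → v ∉ A₁ → ¬ G.Adj u v) :
    TD G w (A₁ ∪ A₂) B₁ := by
  obtain ⟨ι, p, d, root, bag, h1, h2, h3, h4, h5, h6, h7⟩ := h₁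
  obtain ⟨κ, q, e, toor, gab, k1, k2, k3, k4, k5, k6, k7⟩ := h₂
  refine ⟨ι ⊕ κ, Sum.elim (fun i => Sum.inl (p i))
    (fun j => if j = toor then Sum.inl root else Sum.inr (q j)),
    Sum.elim d (fun j => d root + 1 + e j), Sum.inl root, Sum.elim bag gab,
    ?_, h2, ?_, ?_, ?_, ?_, ?_⟩
  · rintro (i | j) hij
    · exact h1 i (by simpa using hij)
    · by_cases hj : j = toor
      · simp [hj]; omega
      · simpa [hj] using k1 j hj
  · rintro (i | j)
    · exact (h3 i).trans Finset.subset_union_left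
    · exact (k3 j).trans Finset.subset_union_right
  · intro v hv
    rcases Finset.mem_union.1 hv with hv | hv
    · obtain ⟨i, hi⟩ := h4 v hv; exact ⟨Sum.inl i, hi⟩
    · obtain ⟨i, hi⟩ := k4 v hv; exact ⟨Sum.inr i, hi⟩
  · intro u hu v hv huv
    by_cases h11 : u ∈ A₁ ∧ v ∈ A₁
    · obtain ⟨i, hi⟩ := h5 u h11.1 v h11.2 huv; exact ⟨Sum.inl i, hi⟩
    by_cases h22 : u ∈ A₂ ∧ v ∈ A₂
    · obtain ⟨i, hi⟩ := k5 u h22.1 v h22.2 huv; exact ⟨Sum.inr i, hi⟩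
    exfalso
    have a1 := hadj u v
    have a2 := hadj v u
    have hvu := huv.symm
    simp only [Finset.mem_union] at hu hv
    tauto
  · intro v hv
    by_cases hv1 : v ∈ A₁
    · obtain ⟨t, ht, hti⟩ := h6 v hv1
      refine ⟨Sum.inl t, ht, ?_⟩
      rintro (i | j) hi hne
      · have := hti i hi (by simpa using hne)
        exact ⟨by simpa using this.1, this.2⟩
      · refine ⟨by simp, ?_⟩
        have hv2 : v ∈ A₂ := k3 j hi
        obtain ⟨hb1, hb2⟩ := hinter v hv1 hv2
        by_cases hj : j = toor
        · simp [hj, h2, hb1]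
        · obtain ⟨s, hs, hsi⟩ := k6 v hv2
          have hst : s = toor := by
            by_contra hne'
            exact (hsi toor (by rw [k2]; exact hb2) (fun h => hne' h.symm)).1 rfl
          have := (hsi j hi (by rw [hst]; exact hj)).2
          simpa [hj] using this
    · have hv2 : v ∈ A₂ := by
        rcases Finset.mem_union.1 hv with h | h
        · exact absurd h hv1
        · exact h
      obtain ⟨t, ht, hti⟩ := k6 v hv2
      refine ⟨Sum.inr t, ht, ?_⟩
      rintro (i | j) hi hne
      · exact absurd (h3 i hi) hv1
      · have := hti j hi (by simpa using hne)
        refine ⟨by simp, ?_⟩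
        simpa [this.1] using this.2
  · rintro (i | j)
    · exact h7 i
    · exact k7 j

open Classical in
lemma TD.addBag {G : SimpleGraph V} {w : ℕ} {A B : Finset V} (h : TD G w A B) (X : Finset V) :
    TD G (w + X.card) (A ∪ X) (B ∪ X) := by
  obtain ⟨ι, p, d, root, bag, h1, h2, h3, h4, h5, h6, h7⟩ := h
  refine ⟨ι, p, d, root, fun i => bag i ∪ X, h1, by simp [h2], ?_, ?_, ?_, ?_, ?_⟩
  · intro i; exact Finset.union_subset_union (h3 i) subset_rfl
  · intro v hv
    rcases Finset.mem_union.1 hv with hv | hv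
    · obtain ⟨i, hi⟩ := h4 v hv; exact ⟨i, Finset.mem_union_left _ hi⟩
    · exact ⟨root, Finset.mem_union_right _ hv⟩
  · intro u hu v hv huv
    by_cases hux : u ∈ X
    · by_cases hvx : v ∈ X
      · exact ⟨root, Finset.mem_union_right _ hux, Finset.mem_union_right _ hvx⟩
      · obtain ⟨i, hi⟩ := h4 v ((Finset.mem_union.1 hv).resolve_right hvx)
        exact ⟨i, Finset.mem_union_right _ hux, Finset.mem_union_left _ hi⟩
    · have hu' := (Finset.mem_union.1 hu).resolve_right hux
      by_cases hvx : v ∈ X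
      · obtain ⟨i, hi⟩ := h4 u hu'
        exact ⟨i, Finset.mem_union_left _ hi, Finset.mem_union_right _ hvx⟩
      · obtain ⟨i, hi, hi'⟩ := h5 u hu' v ((Finset.mem_union.1 hv).resolve_right hvx) huv
        exact ⟨i, Finset.mem_union_left _ hi, Finset.mem_union_left _ hi'⟩
  · intro v hv
    by_cases hvx : v ∈ X
    · refine ⟨root, Finset.mem_union_right _ hvx, fun i _ hne => ⟨hne, Finset.mem_union_right _ hvx⟩⟩
    · obtain ⟨t, ht, hti⟩ := h6 v ((Finset.mem_union.1 hv).resolve_right hvx)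
      refine ⟨t, Finset.mem_union_left _ ht, fun i hi hne => ?_⟩
      have := hti i ((Finset.mem_union.1 hi).resolve_right hvx) hne
      exact ⟨this.1, Finset.mem_union_left _ this.2⟩
  · intro i
    exact (Finset.card_union_le _ _).trans (Nat.add_le_add_right (h7 i) _)

open Classical in
lemma TD.inter {G : SimpleGraph V} {w : ℕ} {A B : Finset V} (h : TD G w A B) (S : Finset V) :
    TD G w (A ∩ S) (B ∩ S) := by
  obtain ⟨ι, p, d, root, bag, h1, h2, h3, h4, h5, h6, h7⟩ := h
  refine ⟨ι, p, d, root, fun i => bag i ∩ S, h1, by simp [h2], ?_, ?_, ?_, ?_, ?_⟩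
  · intro i; exact Finset.inter_subset_inter (h3 i) subset_rfl
  · intro v hv
    obtain ⟨hv, hs⟩ := Finset.mem_inter.1 hv
    obtain ⟨i, hi⟩ := h4 v hv
    exact ⟨i, Finset.mem_inter.2 ⟨hi, hs⟩⟩
  · intro u hu v hv huv
    obtain ⟨hu, hus⟩ := Finset.mem_inter.1 hu
    obtain ⟨hv, hvs⟩ := Finset.mem_inter.1 hv
    obtain ⟨i, hi, hi'⟩ := h5 u hu v hv huv
    exact ⟨i, Finset.mem_inter.2 ⟨hi, hus⟩, Finset.mem_inter.2 ⟨hi', hvs⟩⟩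
  · intro v hv
    obtain ⟨hv, hs⟩ := Finset.mem_inter.1 hv
    obtain ⟨t, ht, hti⟩ := h6 v hv
    refine ⟨t, Finset.mem_inter.2 ⟨ht, hs⟩, fun i hi hne => ?_⟩
    have := hti i (Finset.mem_inter.1 hi).1 hne
    exact ⟨this.1, Finset.mem_inter.2 ⟨this.2, hs⟩⟩
  · intro i
    exact (Finset.card_le_card Finset.inter_subset_left).trans (h7 i)

lemma TD.congr {G G' : SimpleGraph V} {w : ℕ} {A B : Finset V} (h : TD G w A B)
    (hG : ∀ u ∈ A, ∀ v ∈ A, G'.Adj u v → G.Adj u v) : TD G' w A B := by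
  obtain ⟨ι, p, d, root, bag, h1, h2, h3, h4, h5, h6, h7⟩ := h
  exact ⟨ι, p, d, root, bag, h1, h2, h3, h4,
    fun u hu v hv huv => h5 u hu v hv (hG u hu v hv huv), h6, h7⟩

lemma TD.reroot {G : SimpleGraph V} {w : ℕ} {A B B' : Finset V} (h : TD G w A B)
    (hB : B' ⊆ B) : TD G w A B' := by
  classical
  have h1 : TD G w B' B' := TD.single G ((Finset.card_le_card hB).trans h.card)
  have h2 := h1.glue h (fun v hv _ => ⟨hv, hB hv⟩) (fun u v hu hu' _ _ => absurd (h.subset (hB hu)) hu')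
  rwa [Finset.union_eq_right.2 (hB.trans h.subset)] at h2

/-- `g 0, …, g (m-1)` is a cycle of `G` of length `m`, with `g m = g 0`. -/
def IsCyc (G : SimpleGraph V) (m : ℕ) (g : ℕ → V) : Prop :=
  3 ≤ m ∧ (∀ i < m, ∀ j < m, g i = g j → i = j) ∧ (∀ i < m, G.Adj (g i) (g (i + 1))) ∧ g m = g 0

lemma IsCyc.of_isCycle {G : SimpleGraph V} {v : V} {c : G.Walk v v} (hc : c.IsCycle) :
    IsCyc G c.length c.getVert := by
  refine ⟨hc.three_le_length, ?_, ?_, ?_⟩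
  · intro i hi j hj h
    exact hc.getVert_injOn' (by simp; omega) (by simp; omega) h
  · intro i hi
    exact c.adj_getVert_succ hi
  · simp

lemma IsCyc.of_path {G : SimpleGraph V} {u v : V} {p : G.Walk u v} (hp : p.IsPath)
    (h2 : 2 ≤ p.length) (h : G.Adj v u) :
    IsCyc G (p.length + 1) (fun i => if i ≤ p.length then p.getVert i else u) := by
  refine ⟨by omega, ?_, ?_, ?_⟩
  · intro i hi j hj h
    have hi' : i ≤ p.length := by omega
    have hj' : j ≤ p.length := by omega
    simp only [hi', hj', if_true] at h
    exact hp.getVert_injOn (by simpa using hi') (by simpa using hj') h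
  · intro i hi
    have hi' : i ≤ p.length := by omega
    simp only [hi', if_true]
    by_cases h' : i + 1 ≤ p.length
    · simp only [h', if_true]
      exact p.adj_getVert_succ (by omega)
    · have : i = p.length := by omega
      subst this
      simpa using h
  · simp

lemma IsCyc.mono {G G' : SimpleGraph V} {m : ℕ} {g : ℕ → V} (h : IsCyc G m g) (hG : G ≤ G') :
    IsCyc G' m g :=
  ⟨h.1, h.2.1, fun i hi => hG (h.2.2.1 i hi), h.2.2.2⟩

/-- The subgraph of `G` induced on `S`, on the same vertex type. -/
def restr (G : SimpleGraph V) (S : Set V) : SimpleGraph V where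
  Adj u v := G.Adj u v ∧ u ∈ S ∧ v ∈ S
  symm := ⟨fun _ _ h => ⟨h.1.symm, h.2.2, h.2.1⟩⟩
  loopless := ⟨fun _ h => G.loopless.irrefl _ h.1⟩

lemma restr_le (G : SimpleGraph V) (S : Set V) : restr G S ≤ G := fun _ _ h => h.1

lemma restr_mono (G : SimpleGraph V) {S T : Set V} (h : S ⊆ T) : restr G S ≤ restr G T :=
  fun _ _ h' => ⟨h'.1, h h'.2.1, h h'.2.2⟩

lemma restr_support {G : SimpleGraph V} {S : Set V} {u v : V} (p : (restr G S).Walk u v)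
    (hu : u ∈ S) : ∀ x ∈ p.support, x ∈ S := by
  induction p with
  | nil => simpa using hu
  | cons h p ih =>
    intro x hx
    rcases List.mem_cons.1 (by simpa using hx) with rfl | hx
    · exact hu
    · exact ih h.2.2 x hx

lemma restr_reach {G : SimpleGraph V} {S : Set V} {u v : V} (h : (restr G S).Reachable u v) :
    ∀ T : Set V, (∀ x, (restr G S).Reachable u x → x ∈ T) → (restr G T).Reachable u v := by
  obtain ⟨p⟩ := h
  induction p with
  | nil => intro T _; exact Reachable.refl _
  | @cons a b c h p ih =>
    intro T hT
    have hab : (restr G T).Adj a b := ⟨h.1, hT _ (Reachable.refl _), hT _ h.reachable⟩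
    exact hab.reachable.trans (ih T fun x hx => hT x (h.reachable.trans hx))

/-- All cycles inside `U` have length less than `ℓ`. -/
def NoLong (G : SimpleGraph V) (U : Finset V) (ℓ : ℕ) : Prop :=
  ∀ m g, IsCyc G m g → (∀ i, i < m → g i ∈ U) → m < ℓ

open Classical in
/-- Vertices of the walk `P` with a neighbour in `S`. -/
noncomputable def nb (G : SimpleGraph V) {y x : V} (P : G.Walk y x) (S : Finset V) : Finset V :=
  P.support.toFinset.filter (fun v => ∃ s ∈ S, G.Adj v s)

open Classical in
lemma mem_nb {G : SimpleGraph V} {y x : V} {P : G.Walk y x} {S : Finset V} {v : V} :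
    v ∈ nb G P S ↔ v ∈ P.support ∧ ∃ s ∈ S, G.Adj v s := by
  simp [nb]

open Classical in
lemma nb_card {G : SimpleGraph V} {U : Finset V} {ℓ : ℕ} (hℓ : 1 ≤ ℓ) (hU : NoLong G U ℓ)
    {S : Finset V} {x y : V} (P : G.Walk y x) (hP : P.IsPath) (hSU : S ⊆ U)
    (hPU : ∀ v ∈ P.support, v ∈ U ∧ v ∉ S)
    (hr : ∀ s ∈ S, (restr G (insert y (S : Set V))).Reachable s y) :
    (nb G P S).card ≤ ℓ := by
  have : nb G P S ⊆ (Finset.range ℓ).image P.getVert := by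
    intro v hv
    obtain ⟨hvP, s, hs, hadj⟩ := mem_nb.1 hv
    obtain ⟨i, hi, hil⟩ := Walk.mem_support_iff_exists_getVert.1 hvP
    refine Finset.mem_image.2 ⟨i, ?_, hi⟩
    rw [Finset.mem_range]
    by_contra hcon
    push Not at hcon
    obtain ⟨q0⟩ := hr s hs
    set q := q0.toPath with hq
    have hqs : ∀ z ∈ (q : (restr G (insert y (S : Set V))).Walk s y).support, z = y ∨ z ∈ S := by
      intro z hz
      have := restr_support _ (by simp [hs]) z hz
      simpa using this
    set Q : G.Walk s y := (q : (restr G (insert y (S : Set V))).Walk s y).mapLe (restr_le _ _) with hQ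
    have hQp : Q.IsPath := q.2.mapLe _
    have hQs : ∀ z ∈ Q.support, z = y ∨ z ∈ S := by
      intro z hz
      apply hqs
      simpa [hQ] using hz
    have hsy : s ≠ y := by
      rintro rfl
      exact (hPU s P.start_mem_support).2 hs
    have hQl : 1 ≤ Q.length := by
      rcases Nat.eq_zero_or_pos Q.length with h0 | h0
      · exact absurd (Walk.eq_of_length_eq_zero h0) hsy
      · exact h0
    set R := P.take i with hR
    have hRp : R.IsPath := hP.take i
    have hRs : ∀ z ∈ R.support, z ∈ P.support := fun z hz =>
      (P.isSubwalk_take i).support_subset hz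
    have hap : (Q.append R).IsPath := by
      rw [Walk.isPath_def, Walk.support_append, List.nodup_append]
      refine ⟨hQp.support_nodup, hRp.support_nodup.tail, ?_⟩
      intro a ha b hb hab
      subst hab
      rcases hQs a ha with h | h
      · subst h
        have := hRp.support_nodup
        rw [← Walk.cons_tail_support] at this
        exact (List.nodup_cons.1 this).1 hb
      · exact (hPU a (hRs a (List.mem_of_mem_tail hb))).2 h
    have hRl : R.length = i := by
      rw [hR, Walk.take_length]; omega
    have hal : (Q.append R).length = Q.length + i := by
      rw [Walk.length_append, hRl]
    rw [← hi] at hadj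
    have hcyc := IsCyc.of_path hap (by omega) hadj
    have := hU _ _ hcyc (by
      intro j hj
      have hj' : j ≤ (Q.append R).length := by omega
      simp only [hj', if_true]
      have hm := (Q.append R).getVert_mem_support j
      rw [Walk.mem_support_append_iff] at hm
      rcases hm with hm | hm
      · rcases hQs _ hm with h | h
        · rw [h]; exact (hPU y P.start_mem_support).1
        · exact hSU h
      · exact (hPU _ (hRs _ hm)).1)
    omega
  calc _ ≤ _ := Finset.card_le_card this
    _ ≤ (Finset.range ℓ).card := Finset.card_image_le
    _ = ℓ := Finset.card_range ℓ

open Classical in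
lemma dfs {G : SimpleGraph V} {U : Finset V} {ℓ : ℕ} (hℓ : 1 ≤ ℓ) (hU : NoLong G U ℓ) (n : ℕ) :
    ∀ (S : Finset V) (_ : S.card ≤ n) (x y : V) (P : G.Walk y x) (_ : P.IsPath) (_ : S ⊆ U)
    (_ : ∀ v ∈ P.support, v ∈ U ∧ v ∉ S)
    (_ : ∀ s ∈ S, (restr G (insert y (S : Set V))).Reachable s y),
    TD G (ℓ + 1) (nb G P S ∪ S) (nb G P S) := by
  induction n with
  | zero =>
    intro S hS x y P hP hSU hPU hr
    have : S = ∅ := by simpa using hS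
    subst this
    have h := nb_card hℓ hU P hP hSU hPU hr
    simpa using TD.single G (h.trans (Nat.le_succ _))
  | succ n ih =>
    intro S hS x y P hP hSU hPU hr
    have hcard := nb_card hℓ hU P hP hSU hPU hr
    rcases S.eq_empty_or_nonempty with rfl | ⟨s, hs⟩
    · simpa using TD.single G (hcard.trans (Nat.le_succ _))
    have hyS : y ∉ S := (hPU y P.start_mem_support).2
    obtain ⟨s0, hs0, hys0⟩ : ∃ s0 ∈ S, G.Adj s0 y := by
      obtain ⟨q⟩ := (hr s hs).symm
      cases q with
      | nil => exact absurd hs hyS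
      | @cons _ b _ h q =>
        have h2 : b = y ∨ b ∈ S := by simpa using h.2.2
        rcases h2 with rfl | h2
        · exact absurd h.1 (G.loopless.irrefl _)
        · exact ⟨b, h2, h.1.symm⟩
    set S1 := S.filter (fun s => s ≠ s0 ∧ (restr G (S : Set V)).Reachable s0 s) with hS1
    set S2 := S.filter (fun s => ¬ (restr G (S : Set V)).Reachable s0 s) with hS2
    have hm1 : ∀ v, v ∈ S1 ↔ v ∈ S ∧ v ≠ s0 ∧ (restr G (S : Set V)).Reachable s0 v := by
      intro v; simp [hS1]
    have hm2 : ∀ v, v ∈ S2 ↔ v ∈ S ∧ ¬ (restr G (S : Set V)).Reachable s0 v := by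
      intro v; simp [hS2]
    have hs01 : s0 ∉ S1 := by simp [hm1]
    have hs02 : s0 ∉ S2 := by
      simp only [hm2, not_and, not_not]; intro _; exact Reachable.refl _
    have hS1c : S1.card ≤ n := by
      have : S1 ⊂ S := ⟨Finset.filter_subset _ _, fun h => hs01 (h hs0)⟩
      have := Finset.card_lt_card this
      omega
    have hS2c : S2.card ≤ n := by
      have : S2 ⊂ S := ⟨Finset.filter_subset _ _, fun h => hs02 (h hs0)⟩
      have := Finset.card_lt_card this
      omega
    have hs0P : s0 ∉ P.support := fun h => (hPU s0 h).2 hs0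
    have hcl : ∀ u v, u ∈ S → v ∈ S → (restr G (S : Set V)).Reachable s0 u → G.Adj u v →
        (restr G (S : Set V)).Reachable s0 v := by
      intro u v hu hv h huv
      exact h.trans (Adj.reachable (show (restr G (S : Set V)).Adj u v from ⟨huv, hu, hv⟩))
    have T1 := ih S1 hS1c x s0 (Walk.cons hys0 P) (by
        rw [Walk.cons_isPath_iff]; exact ⟨hP, hs0P⟩)
      ((Finset.filter_subset _ _).trans hSU)
      (by
        intro v hv
        rw [Walk.support_cons, List.mem_cons] at hv
        rcases hv with rfl | hv
        · exact ⟨hSU hs0, hs01⟩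
        · exact ⟨(hPU v hv).1, fun h => (hPU v hv).2 ((hm1 v).1 h).1⟩)
      (by
        intro s hs
        obtain ⟨hsS, hne, hre⟩ := (hm1 s).1 hs
        refine (restr_reach hre _ ?_).symm
        intro z hz
        by_cases h : z = s0
        · simp [h]
        · right
          refine Finset.mem_coe.2 ((hm1 z).2 ⟨?_, h, hz⟩)
          obtain ⟨q⟩ := hz
          exact restr_support q (by simpa using hs0) z q.end_mem_support)
    have T2 := ih S2 hS2c x y P hP ((Finset.filter_subset _ _).trans hSU)
      (by
        intro v hv
        exact ⟨(hPU v hv).1, fun h => (hPU v hv).2 ((hm2 v).1 h).1⟩)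
      (by
        intro s hs
        obtain ⟨hsS, hre⟩ := (hm2 s).1 hs
        have key : ∀ a b (q : (restr G (insert y (S : Set V))).Walk a b), b = y →
            (a = y ∨ a ∈ S2) → (restr G (insert y (S2 : Set V))).Reachable a b := by
          intro a b q
          induction q with
          | nil => intro _ _; exact Reachable.refl _
          | @cons a b c h q ihq =>
            intro hc ha
            rcases ha with rfl | ha
            · subst hc; exact Reachable.refl _
            have hb : b = y ∨ b ∈ S2 := by
              have h2 : b = y ∨ b ∈ S := by simpa using h.2.2
              rcases h2 with h2 | h2
              · exact Or.inl h2
              · right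
                obtain ⟨haS, har⟩ := (hm2 a).1 ha
                exact (hm2 b).2 ⟨h2, fun hbr => har (hcl b a h2 haS hbr h.1.symm)⟩
            have hab : (restr G (insert y (S2 : Set V))).Adj a b := by
              refine ⟨h.1, ?_, ?_⟩
              · right; exact ha
              · rcases hb with hb | hb
                · left; exact hb
                · right; exact hb
            exact hab.reachable.trans (ihq hc hb)
        obtain ⟨q⟩ := hr s hsS
        exact key _ _ q rfl (Or.inr hs))
    have hm : ∀ v, v ∈ S → v ≠ s0 → v ∉ S1 → v ∈ S2 := by
      intro v; rw [hm1, hm2]; tauto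
    have hn : ∀ v, v ∈ nb G P S ↔ v ∈ P.support ∧ ∃ s ∈ S, G.Adj v s := fun v => mem_nb
    have hn1 : ∀ v, v ∈ nb G (Walk.cons hys0 P) S1 ↔
        (v = s0 ∨ v ∈ P.support) ∧ ∃ s ∈ S1, G.Adj v s := fun v => by
      rw [mem_nb, Walk.support_cons, List.mem_cons]
    have hn2 : ∀ v, v ∈ nb G P S2 ↔ v ∈ P.support ∧ ∃ s ∈ S2, G.Adj v s := fun v => mem_nb
    have hS1S : ∀ v, v ∈ S1 → v ∈ S := fun v h => ((hm1 v).1 h).1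
    have hS2S : ∀ v, v ∈ S2 → v ∈ S := fun v h => ((hm2 v).1 h).1
    have hPS : ∀ v, v ∈ P.support → v ∉ S := fun v h => (hPU v h).2
    have h12 : ∀ u v, (u = s0 ∨ u ∈ S1) → v ∈ S2 → ¬ G.Adj u v := by
      intro u v hu hv huv
      obtain ⟨hvS, hvr⟩ := (hm2 v).1 hv
      rcases hu with rfl | hu
      · exact hvr (hcl u v hs0 hvS (Reachable.refl _) huv)
      · obtain ⟨huS, _, hur⟩ := (hm1 u).1 hu
        exact hvr (hcl u v huS hvS hur huv)
    have hd12 : ∀ v, v ∈ S1 → v ∉ S2 := by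
      intro v; rw [hm1, hm2]; tauto
    have hB1 : ∀ v, v ∈ nb G (Walk.cons hys0 P) S1 → v ∈ nb G P S ∪ {s0} := by
      intro v hv
      obtain ⟨h1, z, hz, hvz⟩ := (hn1 v).1 hv
      rcases h1 with rfl | h1
      · simp
      · exact Finset.mem_union_left _ ((hn v).2 ⟨h1, z, hS1S z hz, hvz⟩)
    have hB2 : ∀ v, v ∈ nb G P S2 → v ∈ nb G P S := by
      intro v hv
      obtain ⟨h1, z, hz, hvz⟩ := (hn2 v).1 hv
      exact (hn v).2 ⟨h1, z, hS2S z hz, hvz⟩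
    have T0 : TD G (ℓ + 1) (nb G P S ∪ {s0}) (nb G P S ∪ {s0}) := by
      apply TD.single
      calc _ ≤ _ := Finset.card_union_le _ _
        _ ≤ _ := by simpa using hcard
    have T01 := TD.glue T0 T1 (by
        intro v hv hv1
        rcases Finset.mem_union.1 hv1 with h | h
        · exact ⟨hv, h⟩
        · exfalso
          rcases Finset.mem_union.1 hv with h' | h'
          · exact hPS v ((hn v).1 h').1 (hS1S v h)
          · have : v = s0 := by simpa using h'
            subst this; exact hs01 h) (by
        intro u v hu hu1 hv1 hv huv
        rcases Finset.mem_union.1 hv1 with h | h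
        · exact hv (hB1 v h)
        · apply hu1
          refine Finset.mem_union_left _ ((hn1 u).2 ⟨?_, v, h, huv⟩)
          rcases Finset.mem_union.1 hu with h' | h'
          · exact Or.inr ((hn u).1 h').1
          · left; simpa using h')
    have T02 := TD.glue T01 T2 (by
        intro v hv hv2
        rcases Finset.mem_union.1 hv2 with h | h
        · exact ⟨Finset.mem_union_left _ (hB2 v h), h⟩
        · exfalso
          rcases Finset.mem_union.1 hv with hv | hv
          · rcases Finset.mem_union.1 hv with h' | h'
            · exact hPS v ((hn v).1 h').1 (hS2S v h)
            · have : v = s0 := by simpa using h'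
              subst this; exact hs02 h
          · rcases Finset.mem_union.1 hv with h' | h'
            · rcases ((hn1 v).1 h').1 with rfl | h''
              · exact hs02 h
              · exact hPS v h'' (hS2S v h)
            · exact hd12 v h' h) (by
        intro u v hu hu2 hv2 hv huv
        rcases Finset.mem_union.1 hv2 with h | h
        · exact hv (Finset.mem_union_left _ (Finset.mem_union_left _ (hB2 v h)))
        · have hP2 : u ∉ P.support := fun hup =>
            hu2 (Finset.mem_union_left _ ((hn2 u).2 ⟨hup, v, h, huv⟩))
          have : u = s0 ∨ u ∈ S1 := by
            rcases Finset.mem_union.1 hu with hu | hu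
            · rcases Finset.mem_union.1 hu with h' | h'
              · exact absurd ((hn u).1 h').1 hP2
              · left; simpa using h'
            · rcases Finset.mem_union.1 hu with h' | h'
              · rcases ((hn1 u).1 h').1 with h'' | h''
                · exact Or.inl h''
                · exact absurd h'' hP2
              · exact Or.inr h'
          exact h12 u v this h huv)
    have hset : nb G P S ∪ {s0} ∪ (nb G (Walk.cons hys0 P) S1 ∪ S1) ∪ (nb G P S2 ∪ S2)
        = nb G P S ∪ S := by
      ext v
      constructor
      · intro h
        simp only [Finset.mem_union, Finset.mem_singleton] at h ⊢
        rcases h with ((h | h) | (h | h)) | (h | h)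
        · exact Or.inl h
        · subst h; exact Or.inr hs0
        · have := hB1 v h
          simp only [Finset.mem_union, Finset.mem_singleton] at this
          rcases this with h | h
          · exact Or.inl h
          · subst h; exact Or.inr hs0
        · exact Or.inr (hS1S v h)
        · exact Or.inl (hB2 v h)
        · exact Or.inr (hS2S v h)
      · intro h
        simp only [Finset.mem_union, Finset.mem_singleton] at h ⊢
        rcases h with h | h
        · tauto
        · have := hm v h
          tauto
    rw [hset] at T02
    exact T02.reroot (Finset.subset_union_left)

open Classical in
lemma noLong_TD_aux {G : SimpleGraph V} {ℓ : ℕ} (hℓ : 1 ≤ ℓ) (n : ℕ) :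
    ∀ (U : Finset V) (_ : U.card ≤ n) (_ : NoLong G U ℓ), TD G (ℓ + 1) U ∅ := by
  induction n with
  | zero =>
    intro U hU _
    have : U = ∅ := by simpa using hU
    subst this
    exact TD.single G (by simp)
  | succ n ih =>
    intro U hU hN
    rcases U.eq_empty_or_nonempty with rfl | ⟨a, ha⟩
    · exact TD.single G (by simp)
    set S := U.filter (fun s => s ≠ a ∧ (restr G (U : Set V)).Reachable a s) with hS
    set U2 := U.filter (fun s => ¬ (restr G (U : Set V)).Reachable a s) with hU2
    have hmS : ∀ v, v ∈ S ↔ v ∈ U ∧ v ≠ a ∧ (restr G (U : Set V)).Reachable a v := by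
      intro v; simp [hS]
    have hm2 : ∀ v, v ∈ U2 ↔ v ∈ U ∧ ¬ (restr G (U : Set V)).Reachable a v := by
      intro v; simp [hU2]
    have ha2 : a ∉ U2 := by
      simp only [hm2, not_and, not_not]; intro _; exact Reachable.refl _
    have h2c : U2.card ≤ n := by
      have : U2 ⊂ U := ⟨Finset.filter_subset _ _, fun h => ha2 (h ha)⟩
      have := Finset.card_lt_card this
      omega
    have hN2 : NoLong G U2 ℓ := fun m g hg hgU =>
      hN m g hg fun i hi => ((hm2 _).1 (hgU i hi)).1
    have T2 := ih U2 h2c hN2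
    have T1 := dfs hℓ hN S.card S le_rfl a a (Walk.nil) (by simp)
      (Finset.filter_subset _ _) (by
        intro v hv
        have : v = a := by simpa using hv
        subst this
        exact ⟨ha, by simp [hmS]⟩) (by
        intro s hs
        obtain ⟨hsS, hne, hre⟩ := (hmS s).1 hs
        refine (restr_reach hre _ ?_).symm
        intro z hz
        by_cases h : z = a
        · simp [h]
        · right
          refine Finset.mem_coe.2 ((hmS z).2 ⟨?_, h, hz⟩)
          obtain ⟨q⟩ := hz
          exact restr_support q (by simpa using ha) z q.end_mem_support)
    have hnb : ∀ v, v ∈ nb G (Walk.nil : G.Walk a a) S → v = a := by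
      intro v hv; simpa using (mem_nb.1 hv).1
    have T0 : TD G (ℓ + 1) {a} {a} := TD.single G (by simp)
    have T01 := TD.glue T0 T1 (by
        intro v hv hv1
        refine ⟨hv, ?_⟩
        rcases Finset.mem_union.1 hv1 with h | h
        · exact h
        · have : v = a := by simpa using hv
          subst this
          exact absurd rfl ((hmS v).1 h).2.1) (by
        intro u v hu hu1 hv1 hv huv
        have : u = a := by simpa using hu
        subst this
        rcases Finset.mem_union.1 hv1 with h | h
        · exact hv (by simp [hnb v h])
        · exact hu1 (Finset.mem_union_left _ (mem_nb.2 ⟨by simp, v, h, huv⟩)))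
    have hset1 : ({a} : Finset V) ∪ (nb G (Walk.nil : G.Walk a a) S ∪ S) = insert a S := by
      ext v
      simp only [Finset.mem_union, Finset.mem_singleton, Finset.mem_insert]
      have := hnb v
      tauto
    rw [hset1] at T01
    have hin : ∀ v, v ∈ insert a S → v ∈ U ∧ (restr G (U : Set V)).Reachable a v := by
      intro v hv
      rcases Finset.mem_insert.1 hv with rfl | hv
      · exact ⟨ha, Reachable.refl _⟩
      · exact ⟨((hmS v).1 hv).1, ((hmS v).1 hv).2.2⟩
    have T := TD.glue (T01.reroot (Finset.empty_subset _)) T2 (by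
        intro v hv hv2
        exact absurd (hin v hv).2 ((hm2 v).1 hv2).2) (by
        intro u v hu hu2 hv2 hv huv
        obtain ⟨huU, hur⟩ := hin u hu
        obtain ⟨hvU, hvr⟩ := (hm2 v).1 hv2
        exact hvr (hur.trans (Adj.reachable
          (show (restr G (U : Set V)).Adj u v from ⟨huv, huU, hvU⟩))))
    have hset : insert a S ∪ U2 = U := by
      ext v
      simp only [Finset.mem_union, Finset.mem_insert, hmS, hm2]
      by_cases h : v = a
      · subst h; tauto
      · tauto
    rwa [hset] at T

open Classical in
lemma NoLong.TD {G : SimpleGraph V} {ℓ : ℕ} (hℓ : 1 ≤ ℓ) {U : Finset V} (h : NoLong G U ℓ) :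
    TD G (ℓ + 1) U ∅ := noLong_TD_aux hℓ _ U le_rfl h

open Classical in
lemma layer {G : SimpleGraph V} {w0 ℓ : ℕ} (hℓ : 1 ≤ ℓ) (D C : Finset V) (τ : V → ℕ)
    (hdis : ∀ v ∈ D, v ∉ C) (hinj : ∀ u ∈ C, ∀ v ∈ C, τ u = τ v → u = v)
    (hDD : ∀ u ∈ D, ∀ v ∈ D, G.Adj u v → τ u = τ v)
    (hDC : ∀ u ∈ D, ∀ v ∈ C, G.Adj u v → τ u ≤ τ v ∧ τ v < τ u + ℓ)
    (hCC : ∀ u ∈ C, ∀ v ∈ C, G.Adj u v → τ u < τ v + ℓ)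
    (hlay : ∀ i, TD G w0 (D.filter (fun v => τ v = i)) ∅) (n : ℕ) :
    TD G (w0 + ℓ) (D.filter (fun v => τ v ≤ n) ∪ C.filter (fun v => τ v < n + ℓ))
      (C.filter (fun v => n ≤ τ v ∧ τ v < n + ℓ)) := by
  have hW : ∀ n, (C.filter (fun v => n ≤ τ v ∧ τ v < n + ℓ)).card ≤ ℓ := by
    intro n
    calc _ ≤ (Finset.Ico n (n + ℓ)).card := by
          apply Finset.card_le_card_of_injOn τ
          · intro v hv
            simpa using (Finset.mem_filter.1 hv).2
          · intro u hu v hv h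
            exact hinj u (Finset.mem_filter.1 hu).1 v (Finset.mem_filter.1 hv).1 h
      _ = ℓ := by simp
  have hL : ∀ n, TD G (w0 + ℓ) (D.filter (fun v => τ v = n) ∪
      C.filter (fun v => n ≤ τ v ∧ τ v < n + ℓ)) (C.filter (fun v => n ≤ τ v ∧ τ v < n + ℓ)) := by
    intro n
    have := (hlay n).addBag (C.filter (fun v => n ≤ τ v ∧ τ v < n + ℓ))
    rw [Finset.empty_union] at this
    exact this.mono (by have := hW n; omega)
  induction n with
  | zero =>
    have := hL 0
    simpa using this
  | succ n ih =>
    have := TD.glue (hL (n + 1)) ih (by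
        intro v hv hv'
        simp only [Finset.mem_union, Finset.mem_filter] at hv hv' ⊢
        have := hdis v
        grind) (by
        intro u v hu hu' hv hv' huv
        simp only [Finset.mem_union, Finset.mem_filter] at hu hu' hv hv'
        have h1 := hDD u
        have h2 := hDC u
        have h3 := hDC v
        have h4 := hCC u
        have huv' := huv.symm
        grind)
    convert this using 1
    ext v
    simp only [Finset.mem_union, Finset.mem_filter]
    grind

open Classical in
lemma layer_TD {G : SimpleGraph V} {w0 ℓ : ℕ} (hℓ : 1 ≤ ℓ) (D C : Finset V) (τ : V → ℕ)
    (hdis : ∀ v ∈ D, v ∉ C) (hinj : ∀ u ∈ C, ∀ v ∈ C, τ u = τ v → u = v)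
    (hDD : ∀ u ∈ D, ∀ v ∈ D, G.Adj u v → τ u = τ v)
    (hDC : ∀ u ∈ D, ∀ v ∈ C, G.Adj u v → τ u ≤ τ v ∧ τ v < τ u + ℓ)
    (hCC : ∀ u ∈ C, ∀ v ∈ C, G.Adj u v → τ u < τ v + ℓ)
    (hlay : ∀ i, TD G w0 (D.filter (fun v => τ v = i)) ∅) :
    TD G (w0 + ℓ) (D ∪ C) ∅ := by
  have h := layer hℓ D C τ hdis hinj hDD hDC hCC hlay (∑ v ∈ D ∪ C, τ v + 1)
  have hle : ∀ v ∈ D ∪ C, τ v ≤ ∑ v ∈ D ∪ C, τ v := fun v hv =>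
    Finset.single_le_sum (f := τ) (fun _ _ => Nat.zero_le _) hv
  have h1 : D.filter (fun v => τ v ≤ ∑ v ∈ D ∪ C, τ v + 1) = D := by
    apply Finset.filter_true_of_mem
    intro v hv
    have := hle v (Finset.mem_union_left _ hv)
    omega
  have h2 : C.filter (fun v => τ v < ∑ v ∈ D ∪ C, τ v + 1 + ℓ) = C := by
    apply Finset.filter_true_of_mem
    intro v hv
    have := hle v (Finset.mem_union_right _ hv)
    omega
  rw [h1, h2] at h
  exact h.reroot (Finset.empty_subset _)

open Classical in
/-- Degree of `v` into `A`. -/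
noncomputable def dg (F : SimpleGraph V) (A : Finset V) (v : V) : ℕ :=
  (A.filter (fun w => F.Adj v w)).card

open Classical in
/-- Ordered adjacent pairs inside `A`. -/
noncomputable def prs (F : SimpleGraph V) (A : Finset V) : Finset (V × V) :=
  (A ×ˢ A).filter (fun q => F.Adj q.1 q.2)

lemma mem_prs {F : SimpleGraph V} {A : Finset V} {q : V × V} :
    q ∈ prs F A ↔ (q.1 ∈ A ∧ q.2 ∈ A) ∧ F.Adj q.1 q.2 := by
  simp [prs]

/-- A nonempty vertex set spanning at least as many edges as vertices. -/
def Cyclic (F : SimpleGraph V) (A : Finset V) : Prop :=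
  A.Nonempty ∧ 2 * A.card ≤ (prs F A).card

open Classical in
lemma prs_card_eq_sum (F : SimpleGraph V) (A : Finset V) :
    (prs F A).card = ∑ v ∈ A, dg F A v := by
  rw [prs, Finset.card_filter, Finset.sum_product]
  apply Finset.sum_congr rfl
  intro v _
  rw [dg, Finset.card_filter]

open Classical in
lemma dg_insert {F : SimpleGraph V} {A : Finset V} {v : V} (hv : v ∉ A) (u : V) :
    dg F (insert v A) u = dg F A u + if F.Adj u v then 1 else 0 := by
  unfold dg
  rw [Finset.filter_insert]
  split_ifs with h
  · rw [Finset.card_insert_of_notMem (by simp [hv])]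
  · rfl

open Classical in
lemma prs_insert {F : SimpleGraph V} {A : Finset V} {v : V} (hv : v ∉ A) :
    (prs F (insert v A)).card = (prs F A).card + 2 * dg F A v := by
  rw [prs_card_eq_sum, prs_card_eq_sum, Finset.sum_insert hv]
  simp only [dg_insert hv]
  rw [Finset.sum_add_distrib]
  have h1 : ∑ u ∈ A, (if F.Adj u v then 1 else 0) = dg F A v := by
    rw [dg, Finset.card_filter]
    apply Finset.sum_congr rfl
    intro u _
    simp [F.adj_comm]
  rw [h1]
  simp
  ring

open Classical in
lemma prs_erase {F : SimpleGraph V} {A : Finset V} {v : V} (hv : v ∈ A) :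
    (prs F A).card = (prs F (A.erase v)).card + 2 * dg F A v := by
  have h := prs_insert (F := F) (Finset.notMem_erase v A)
  rw [Finset.insert_erase hv] at h
  have h2 := dg_insert (F := F) (Finset.notMem_erase v A) v
  rw [Finset.insert_erase hv] at h2
  simp at h2
  rw [h, h2]

open Classical in
lemma dg_lt {F : SimpleGraph V} {A : Finset V} {v : V} (hv : v ∈ A) : dg F A v < A.card := by
  apply Finset.card_lt_card
  refine ⟨Finset.filter_subset _ _, fun h => ?_⟩
  have := h hv
  simp at this

open Classical in
lemma dg_erase_le {F : SimpleGraph V} {A : Finset V} (v u : V) :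
    dg F A u ≤ dg F (A.erase v) u + 1 := by
  by_cases hv : v ∈ A
  · have h2 := dg_insert (F := F) (Finset.notMem_erase v A) u
    rw [Finset.insert_erase hv] at h2
    rw [h2]
    split_ifs <;> omega
  · rw [Finset.erase_eq_of_notMem hv]; omega

open Classical in
lemma dg_erase_of_adj {F : SimpleGraph V} {A : Finset V} (v u : V) :
    dg F (A.erase v) u ≤ dg F A u :=
  Finset.card_le_card (Finset.filter_subset_filter _ (Finset.erase_subset _ _))

open Classical in
/-- A cyclic set contains a cardinality minimal cyclic set. -/
lemma exists_min_cyclic {F : SimpleGraph V} {A : Finset V} (h : Cyclic F A) :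
    ∃ B ⊆ A, Cyclic F B ∧ ∀ C ⊆ A, Cyclic F C → B.card ≤ C.card := by
  obtain ⟨B, hB, hmin⟩ := (A.powerset.filter (Cyclic F)).exists_min_image Finset.card
    ⟨A, by simp [h]⟩
  simp only [Finset.mem_filter, Finset.mem_powerset] at hB hmin
  exact ⟨B, hB.1, hB.2, fun C hC hC' => hmin C ⟨hC, hC'⟩⟩

open Classical in
/-- Structure of minimal cyclic sets. -/
lemma min_cyclic_deg {F : SimpleGraph V} {B : Finset V} (h : Cyclic F B)
    (hmin : ∀ C ⊆ B, Cyclic F C → B.card ≤ C.card) :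
    (∀ v ∈ B, 2 ≤ dg F B v) ∧ (prs F B).card ≤ 2 * B.card + 1 := by
  obtain ⟨hne, hc⟩ := h
  have hne2 : ∀ v ∈ B, (B.erase v).Nonempty := by
    intro v hv
    rw [Finset.nonempty_iff_ne_empty]
    intro h0
    have h1 := prs_erase (F := F) hv
    have h2 := dg_lt (F := F) hv
    have h3 := Finset.card_erase_of_mem hv
    rw [h0] at h1 h3
    have h6 : (prs F ∅).card = 0 := by simp [prs]
    rw [h6] at h1
    rw [Finset.card_empty] at h3
    have : 0 < B.card := Finset.card_pos.2 ⟨v, hv⟩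
    omega
  have hlt : ∀ v ∈ B, (prs F B).card + 2 < 2 * B.card + 2 * dg F B v := by
    intro v hv
    by_contra hcon
    have h1 := prs_erase (F := F) hv
    have h3 := Finset.card_erase_of_mem hv
    have h4 : 0 < B.card := Finset.card_pos.2 ⟨v, hv⟩
    have h5 : Cyclic F (B.erase v) := ⟨hne2 v hv, by omega⟩
    have := hmin _ (Finset.erase_subset _ _) h5
    omega
  have h2 : ∀ v ∈ B, 2 ≤ dg F B v := by
    intro v hv
    have := hlt v hv
    omega
  refine ⟨h2, ?_⟩
  by_contra hcon
  have h3 : ∀ v ∈ B, 3 ≤ dg F B v := by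
    intro v hv
    have := hlt v hv
    omega
  obtain ⟨v, hv, hvmin⟩ := B.exists_min_image (dg F B) hne
  have hs : B.card * dg F B v ≤ (prs F B).card := by
    rw [prs_card_eq_sum]
    simpa using Finset.card_nsmul_le_sum B (dg F B) (dg F B v) (fun x hx => hvmin x hx)
  have h4 := hlt v hv
  have h5 := dg_lt (F := F) hv
  have h6 := h3 v hv
  obtain ⟨d, hd⟩ : ∃ d, dg F B v = d + 3 := ⟨_, (Nat.sub_add_cancel h6).symm⟩
  obtain ⟨b, hb⟩ : ∃ b, B.card = d + 4 + b := ⟨_, (Nat.add_sub_cancel' (by omega)).symm⟩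
  rw [hd, hb] at hs h4
  nlinarith

lemma IsCyc.of_min_deg [Fintype V] {F : SimpleGraph V} {B : Finset V} (hne : B.Nonempty)
    (h2 : ∀ v ∈ B, 2 ≤ dg F B v) : ∃ m g, IsCyc F m g ∧ ∀ i < m, g i ∈ B := by
  classical
  by_contra hcon
  have key : ∀ n, ∃ u v, ∃ p : F.Walk u v, p.IsPath ∧ (∀ x ∈ p.support, x ∈ B) ∧ p.length = n := by
    intro n
    induction n with
    | zero =>
      obtain ⟨v, hv⟩ := hne
      exact ⟨v, v, Walk.nil, by simp, by simpa using hv, rfl⟩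
    | succ n ih =>
      obtain ⟨u, v, p, hp, hpB, hl⟩ := ih
      have hu := h2 u (hpB u p.start_mem_support)
      by_cases hex : ∃ x ∈ B, F.Adj u x ∧ x ∉ p.support
      · obtain ⟨x, hxB, hux, hxp⟩ := hex
        refine ⟨x, v, Walk.cons hux.symm p, ?_, ?_, by simp [hl]⟩
        · rw [Walk.cons_isPath_iff]; exact ⟨hp, hxp⟩
        · intro z hz
          rw [Walk.support_cons, List.mem_cons] at hz
          rcases hz with rfl | hz
          · exact hxB
          · exact hpB z hz
      · exfalso
        push Not at hex
        obtain ⟨a, ha, b, hb, hab⟩ := Finset.one_lt_card.1 (show 1 < _ from hu)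
        simp only [Finset.mem_filter] at ha hb
        obtain ⟨x, hxB, hux, hx1⟩ : ∃ x ∈ B, F.Adj u x ∧ x ≠ p.getVert 1 := by
          by_cases h : a = p.getVert 1
          · exact ⟨b, hb.1, hb.2, fun h' => hab (h.trans h'.symm)⟩
          · exact ⟨a, ha.1, ha.2, h⟩
        obtain ⟨j, hj, hjl⟩ := Walk.mem_support_iff_exists_getVert.1 (hex x hxB hux)
        have hj0 : j ≠ 0 := by
          rintro rfl
          rw [Walk.getVert_zero] at hj
          subst hj
          exact F.loopless.irrefl _ hux
        have hj1 : j ≠ 1 := by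
          rintro rfl
          exact hx1 hj.symm
        have hlen : (p.take j).length = j := by
          rw [Walk.take_length]; omega
        have hcyc := IsCyc.of_path (hp.take j) (by omega) (by rw [hj]; exact hux.symm)
        refine hcon ⟨_, _, hcyc, ?_⟩
        intro i hi
        have hi' : i ≤ (p.take j).length := by omega
        simp only [hi', if_true]
        exact hpB _ ((p.isSubwalk_take j).support_subset (Walk.getVert_mem_support _ _))
  obtain ⟨u, v, p, hp, -, hl⟩ := key (Fintype.card V)
  have := hp.length_lt
  omega

lemma Cyclic.isCyc [Fintype V] {F : SimpleGraph V} {A : Finset V} (h : Cyclic F A) :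
    ∃ m g, IsCyc F m g ∧ ∀ i < m, g i ∈ A := by
  obtain ⟨B, hBA, hB, hmin⟩ := exists_min_cyclic h
  obtain ⟨h2, -⟩ := min_cyclic_deg hB fun C hC hC' => hmin C (hC.trans hBA) hC'
  obtain ⟨m, g, hg, hgB⟩ := IsCyc.of_min_deg hB.1 h2
  exact ⟨m, g, hg, fun i hi => hBA (hgB i hi)⟩

open Classical in
lemma q3 (F : SimpleGraph V) (r : ℕ) : ∀ (Y : Finset V), Y.Nonempty →
    (∀ y ∈ Y, 4 * r ≤ dg F Y y) → ∃ C : Fin r → Finset V,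
      (∀ i, C i ⊆ Y ∧ Cyclic F (C i)) ∧ ∀ i j, i ≠ j → Disjoint (C i) (C j) := by
  induction r with
  | zero => intro Y _ _; exact ⟨fun _ => ∅, fun i => i.elim0, fun i => i.elim0⟩
  | succ r ih =>
    intro Y hY hd
    have hYc : Cyclic F Y := by
      refine ⟨hY, ?_⟩
      rw [prs_card_eq_sum]
      have := Finset.card_nsmul_le_sum Y (dg F Y) 2 (fun x hx => by have := hd x hx; omega)
      simpa [mul_comm] using this
    obtain ⟨A, hAY, hA, hmin⟩ := exists_min_cyclic hYc
    obtain ⟨h2, he⟩ := min_cyclic_deg hA fun C hC hC' => hmin C (hC.trans hAY) hC'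
    have hA3 : 3 ≤ A.card := by
      obtain ⟨v, hv⟩ := hA.1
      have := h2 v hv
      have := dg_lt (F := F) hv
      omega
    -- at most one vertex of degree more than two
    have hone : ∀ u ∈ A, ∀ v ∈ A, u ≠ v → dg F A u + dg F A v ≤ 5 := by
      intro u hu v hv huv
      rw [prs_card_eq_sum, ← Finset.add_sum_erase _ _ hu,
        ← Finset.add_sum_erase _ _ (Finset.mem_erase.2 ⟨huv.symm, hv⟩)] at he
      have h1 : _ ≤ ∑ x ∈ (A.erase u).erase v, dg F A x :=
        Finset.card_nsmul_le_sum ((A.erase u).erase v) (dg F A) 2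
        (fun x hx => h2 x (Finset.mem_of_mem_erase (Finset.mem_of_mem_erase hx)))
      rw [Finset.card_erase_of_mem (Finset.mem_erase.2 ⟨huv.symm, hv⟩),
        Finset.card_erase_of_mem hu] at h1
      simp only [smul_eq_mul] at h1
      omega
    obtain ⟨x, hx, y, hy, hxy, hdx, hdy⟩ : ∃ x ∈ A, ∃ y ∈ A, x ≠ y ∧ dg F A x = 2 ∧ dg F A y = 2 := by
      obtain ⟨a, b, c, ha, hb, hc, hab, hac, hbc⟩ := Finset.two_lt_card_iff.1 hA3
      have h1 := hone a ha b hb hab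
      have h3 := hone a ha c hc hac
      have h4 := hone b hb c hc hbc
      have := h2 a ha
      have := h2 b hb
      have := h2 c hc
      by_cases h5 : dg F A a = 2
      · by_cases h6 : dg F A b = 2
        · exact ⟨a, ha, b, hb, hab, h5, h6⟩
        · exact ⟨a, ha, c, hc, hac, h5, by omega⟩
      · exact ⟨b, hb, c, hc, hbc, by omega, by omega⟩
    have h4 : ∀ v ∈ Y, v ∉ A → dg F A v ≤ 4 := by
      intro v hvY hvA
      by_contra hcon
      have hxe : x ∈ A.erase y := Finset.mem_erase.2 ⟨hxy, hx⟩
      have hv' : v ∉ (A.erase y).erase x := fun h =>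
        hvA (Finset.mem_of_mem_erase (Finset.mem_of_mem_erase h))
      have e1 := prs_erase (F := F) hy
      have e2 := prs_erase (F := F) hxe
      have e3 := prs_insert (F := F) hv'
      have e4 := dg_erase_of_adj (F := F) (A := A) y x
      have e5 := dg_erase_le (F := F) (A := A) y v
      have e6 := dg_erase_le (F := F) (A := A.erase y) x v
      have c1 := Finset.card_erase_of_mem hy
      have c2 := Finset.card_erase_of_mem hxe
      have c3 := Finset.card_insert_of_notMem hv'
      have hA2 := hA.2
      have hcy : Cyclic F (insert v ((A.erase y).erase x)) := by
        refine ⟨⟨v, by simp⟩, by omega⟩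
      have := hmin _ (by
        intro z hz
        rcases Finset.mem_insert.1 hz with rfl | hz
        · exact hvY
        · exact hAY (Finset.mem_of_mem_erase (Finset.mem_of_mem_erase hz))) hcy
      omega
    have hsplit : ∀ v, dg F Y v = dg F A v + dg F (Y \ A) v := by
      intro v
      unfold dg
      rw [← Finset.card_union_of_disjoint, ← Finset.filter_union,
        Finset.union_sdiff_of_subset hAY]
      exact Finset.disjoint_filter_filter Finset.disjoint_sdiff
    have hne : (Y \ A).Nonempty := by
      have h1 := hsplit x
      have h5 := hd x (hAY hx)
      have : 0 < dg F (Y \ A) x := by omega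
      obtain ⟨z, hz⟩ := Finset.card_pos.1 this
      exact ⟨z, (Finset.mem_filter.1 hz).1⟩
    obtain ⟨C, hC, hdis⟩ := ih (Y \ A) hne (by
      intro v hv
      rw [Finset.mem_sdiff] at hv
      have := hsplit v
      have := h4 v hv.1 hv.2
      have := hd v hv.1
      omega)
    have hdA : ∀ i, Disjoint A (C i) := fun i =>
      Finset.disjoint_of_subset_right (hC i).1 Finset.disjoint_sdiff
    refine ⟨Fin.cons A C, ?_, ?_⟩
    · intro i
      refine Fin.cases ?_ (fun i => ?_) i
      · simpa using ⟨hAY, hA⟩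
      · simpa using ⟨(hC i).1.trans Finset.sdiff_subset, (hC i).2⟩
    · intro i j
      refine Fin.cases ?_ (fun i => ?_) i
      · refine Fin.cases ?_ (fun j => ?_) j
        · intro h; exact absurd rfl h
        · intro _; simpa using hdA j
      · refine Fin.cases ?_ (fun j => ?_) j
        · intro _; simpa using (hdA i).symm
        · intro h
          simpa using hdis i j (fun h' => h (by rw [h']))

/-- A breadth-first forest structure: depth `d`, parent `p`, root `a`. -/
structure Str (F : SimpleGraph V) (ρ : ℕ) (d : V → ℕ) (p a : V → V) : Prop where
  root : ∀ v, d v = 0 → a v = v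
  par : ∀ v, 0 < d v → F.Adj v (p v) ∧ d (p v) + 1 = d v ∧ a (p v) = a v
  le : ∀ v, d v ≤ 2 * ρ
  near : ∀ u v, F.Adj u v → d u < ρ → a v = a u ∧ d v ≤ d u + 1

open Classical in
lemma exists_str [Fintype V] (F : SimpleGraph V) (ρ : ℕ) : ∃ d p a, Str F ρ d p a := by
  let near : V → V → Prop := fun y v => ∃ w : F.Walk y v, w.length ≤ ρ
  let good : Finset V → Prop := fun Y => ∀ y ∈ Y, ∀ z ∈ Y, ∀ v, near y v → near z v → y = z
  obtain ⟨Y, hY, hmax⟩ := ((Finset.univ : Finset (Finset V)).filter good).exists_max_image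
    Finset.card ⟨∅, by simp [good]⟩
  simp only [Finset.mem_filter, Finset.mem_univ, true_and] at hY hmax
  have hcov : ∀ v, ∃ n, ∃ y ∈ Y, ∃ w : F.Walk y v, w.length = n ∧ n ≤ 2 * ρ := by
    intro v
    by_cases hv : v ∈ Y
    · exact ⟨0, v, hv, Walk.nil, rfl, Nat.zero_le _⟩
    by_contra hcon
    have hg : good (insert v Y) := by
      have hvy : ∀ y ∈ Y, ∀ x, near y x → near v x → False := by
        rintro y hy x ⟨w1, h1⟩ ⟨w2, h2⟩
        apply hcon
        refine ⟨_, y, hy, w1.append w2.reverse, rfl, ?_⟩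
        simp only [Walk.length_append, Walk.length_reverse]
        omega
      intro y hy z hz x hyx hzx
      rcases Finset.mem_insert.1 hy with rfl | hyY
      · rcases Finset.mem_insert.1 hz with rfl | hz
        · rfl
        · exact (hvy z hz x hzx hyx).elim
      · rcases Finset.mem_insert.1 hz with rfl | hz
        · exact (hvy y hyY x hyx hzx).elim
        · exact hY y hyY z hz x hyx hzx
    have := hmax _ hg
    rw [Finset.card_insert_of_notMem hv] at this
    omega
  have hcov' : ∀ v, ∃ n, ∃ y ∈ Y, ∃ w : F.Walk y v, w.length = n := by
    intro v
    obtain ⟨n, y, hy, w, hw, -⟩ := hcov v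
    exact ⟨n, y, hy, w, hw⟩
  let d : V → ℕ := fun v => Nat.find (hcov' v)
  have hd : ∀ v, ∃ y ∈ Y, ∃ w : F.Walk y v, w.length = d v := fun v => Nat.find_spec (hcov' v)
  have hdmin : ∀ v y, y ∈ Y → ∀ w : F.Walk y v, d v ≤ w.length := fun v y hy w =>
    Nat.find_min' (hcov' v) ⟨y, hy, w, rfl⟩
  have hadj : ∀ u v, F.Adj u v → d v ≤ d u + 1 := by
    intro u v huv
    obtain ⟨y, hy, w, hw⟩ := hd u
    have := hdmin v y hy (w.concat huv)
    rw [Walk.length_concat] at this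
    omega
  have hpar : ∀ v, ∃ u, 0 < d v → F.Adj v u ∧ d u + 1 = d v := by
    intro v
    by_cases h0 : 0 < d v
    · obtain ⟨y, hy, w, hw⟩ := hd v
      have hnn : ¬ w.Nil := by
        intro h
        have := Walk.length_eq_zero_iff.2 h
        omega
      refine ⟨w.penultimate, fun _ => ?_⟩
      have hA := w.adj_penultimate hnn
      refine ⟨hA.symm, ?_⟩
      have h1 := hadj _ _ hA
      have h2 := hdmin _ y hy w.dropLast
      rw [Walk.dropLast, Walk.take_length] at h2
      omega
    · exact ⟨v, fun h => absurd h h0⟩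
  choose p hp using hpar
  have hz : ∀ v, d v = 0 → v ∈ Y := by
    intro v h0
    obtain ⟨y, hy, w, hw⟩ := hd v
    rw [h0] at hw
    rw [← Walk.eq_of_length_eq_zero hw]
    exact hy
  let a : V → V := fun v => p^[d v] v
  have hap : ∀ v, 0 < d v → a (p v) = a v := by
    intro v h0
    have := (hp v h0).2
    show p^[d (p v)] (p v) = p^[d v] v
    rw [← this, Function.iterate_succ_apply]
  have hwalk : ∀ n v, d v = n → a v ∈ Y ∧ ∃ w : F.Walk (a v) v, w.length = d v := by
    intro n
    induction n with
    | zero =>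
      intro v h0
      have hav : a v = v := by show p^[d v] v = v; rw [h0]; rfl
      rw [hav]
      exact ⟨hz v h0, Walk.nil, by simp [h0]⟩
    | succ n ih =>
      intro v hn
      have h0 : 0 < d v := by omega
      have h1 := hp v h0
      obtain ⟨hY', w, hw⟩ := ih (p v) (by omega)
      rw [hap v h0] at hY' 
      refine ⟨hY', ?_⟩
      rw [← hap v h0]
      refine ⟨w.concat h1.1.symm, ?_⟩
      rw [Walk.length_concat]; omega
  refine ⟨d, p, a, ?_, ?_, ?_, ?_⟩
  · intro v h0
    show p^[d v] v = v
    rw [h0]; rfl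
  · intro v h0
    exact ⟨(hp v h0).1, (hp v h0).2, hap v h0⟩
  · intro v
    obtain ⟨n, y, hy, w, hw, hn⟩ := hcov v
    have := hdmin v y hy w
    omega
  · intro u v huv hu
    have h1 := hadj u v huv
    refine ⟨?_, h1⟩
    obtain ⟨hv1, w1, hw1⟩ := hwalk _ v rfl
    obtain ⟨hu1, w2, hw2⟩ := hwalk _ u rfl
    refine hY _ hv1 _ hu1 v ⟨w1, by omega⟩ ⟨w2.concat huv, ?_⟩
    rw [Walk.length_concat]; omega

namespace Str
variable {F : SimpleGraph V} {ρ : ℕ} {d : V → ℕ} {p a : V → V}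

lemma droot (h : Str F ρ d p a) : ∀ n v, d v = n → d (a v) = 0 := by
  intro n
  induction n with
  | zero => intro v hv; rw [h.root v hv, hv]
  | succ n ih =>
    intro v hv
    have h1 := h.par v (by omega)
    rw [← h1.2.2]
    exact ih _ (by omega)

lemma aroot (h : Str F ρ d p a) (v : V) : a (a v) = a v := h.root _ (h.droot _ v rfl)

/-- Ordered pair is a parent pair. -/
def PP (_h : Str F ρ d p a) (q : V × V) : Prop :=
  (0 < d q.1 ∧ q.2 = p q.1) ∨ (0 < d q.2 ∧ q.1 = p q.2)

open Classical in
lemma count (h : Str F ρ d p a) {A : Finset V} (hA : ∀ v ∈ A, 0 < d v → p v ∈ A)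
    {X : Finset (V × V)} (hX : X ⊆ prs F A) (hXP : ∀ q ∈ X, ¬ h.PP q) :
    2 * (A.filter (fun v => 0 < d v)).card + X.card ≤ (prs F A).card := by
  set N := A.filter (fun v => 0 < d v) with hN
  have hmN : ∀ v, v ∈ N ↔ v ∈ A ∧ 0 < d v := fun v => by simp [hN]
  have hI1 : (N.image (fun v => (v, p v))).card = N.card :=
    Finset.card_image_of_injective _ (fun u v huv => (Prod.mk.inj huv).1)
  have hI2 : (N.image (fun v => (p v, v))).card = N.card :=
    Finset.card_image_of_injective _ (fun u v huv => (Prod.mk.inj huv).2)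
  have hd1 : Disjoint (N.image (fun v => (v, p v))) (N.image (fun v => (p v, v))) := by
    rw [Finset.disjoint_left]
    rintro ⟨x, y⟩ h1 h2
    obtain ⟨u, hu, hu'⟩ := Finset.mem_image.1 h1
    obtain ⟨v, hv, hv'⟩ := Finset.mem_image.1 h2
    obtain ⟨rfl, rfl⟩ := Prod.mk.inj hu'
    obtain ⟨e1, e2⟩ := Prod.mk.inj hv'
    have d1 := (h.par u ((hmN u).1 hu).2).2.1
    have d2 := (h.par v ((hmN v).1 hv).2).2.1
    rw [e1] at d2
    rw [e2] at d2
    omega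
  have hd2 : Disjoint (N.image (fun v => (v, p v)) ∪ N.image (fun v => (p v, v))) X := by
    rw [Finset.disjoint_left]
    rintro ⟨x, y⟩ h1 h2
    apply hXP _ h2
    rcases Finset.mem_union.1 h1 with h1 | h1
    · obtain ⟨u, hu, hu'⟩ := Finset.mem_image.1 h1
      obtain ⟨rfl, rfl⟩ := Prod.mk.inj hu'
      exact Or.inl ⟨((hmN u).1 hu).2, rfl⟩
    · obtain ⟨u, hu, hu'⟩ := Finset.mem_image.1 h1
      obtain ⟨rfl, rfl⟩ := Prod.mk.inj hu'
      exact Or.inr ⟨((hmN u).1 hu).2, rfl⟩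
  have hsub : N.image (fun v => (v, p v)) ∪ N.image (fun v => (p v, v)) ∪ X ⊆ prs F A := by
    refine Finset.union_subset (Finset.union_subset ?_ ?_) hX
    · intro q hq
      obtain ⟨u, hu, rfl⟩ := Finset.mem_image.1 hq
      obtain ⟨h1, h2⟩ := (hmN u).1 hu
      exact mem_prs.2 ⟨⟨h1, hA u h1 h2⟩, (h.par u h2).1⟩
    · intro q hq
      obtain ⟨u, hu, rfl⟩ := Finset.mem_image.1 hq
      obtain ⟨h1, h2⟩ := (hmN u).1 hu
      exact mem_prs.2 ⟨⟨hA u h1 h2, h1⟩, (h.par u h2).1.symm⟩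
  have := Finset.card_le_card hsub
  rw [Finset.card_union_of_disjoint hd2, Finset.card_union_of_disjoint hd1, hI1, hI2] at this
  omega

open Classical in
lemma cyclic (h : Str F ρ d p a) {A : Finset V} (hne : A.Nonempty)
    (hA : ∀ v ∈ A, 0 < d v → p v ∈ A) (R : Finset V) (hR : ∀ v ∈ A, a v ∈ R)
    {X : Finset (V × V)} (hX : X ⊆ prs F A) (hXP : ∀ q ∈ X, ¬ h.PP q)
    (hc : 2 * R.card ≤ X.card) : Cyclic F A := by
  refine ⟨hne, ?_⟩
  have h1 := h.count hA hX hXP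
  have h2 : A.card = (A.filter (fun v => 0 < d v)).card + (A.filter (fun v => ¬ 0 < d v)).card :=
    (Finset.card_filter_add_card_filter_not _).symm
  have h3 : (A.filter (fun v => ¬ 0 < d v)).card ≤ R.card := by
    apply Finset.card_le_card
    intro v hv
    obtain ⟨hv1, hv2⟩ := Finset.mem_filter.1 hv
    have := hR v hv1
    rwa [h.root v (by omega)] at this
  omega

open Classical in
lemma exists_anc (h : Str F ρ d p a) : ∀ n v, d v = n → ∃ A : Finset V, v ∈ A ∧
    (∀ x ∈ A, 0 < d x → p x ∈ A) ∧ (∀ x ∈ A, a x = a v) ∧ A.card ≤ n + 1 := by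
  intro n
  induction n with
  | zero =>
    intro v hv
    refine ⟨{v}, by simp, ?_, by simp, by simp⟩
    intro x hx h0
    have : x = v := by simpa using hx
    subst this
    omega
  | succ n ih =>
    intro v hv
    have h1 := h.par v (by omega)
    obtain ⟨A, hA1, hA2, hA3, hA4⟩ := ih (p v) (by omega)
    refine ⟨insert v A, by simp, ?_, ?_, ?_⟩
    · intro x hx h0
      rcases Finset.mem_insert.1 hx with rfl | hx
      · exact Finset.mem_insert_of_mem hA1
      · exact Finset.mem_insert_of_mem (hA2 x hx h0)
    · intro x hx
      rcases Finset.mem_insert.1 hx with rfl | hx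
      · rfl
      · rw [hA3 x hx, h1.2.2]
    · have := Finset.card_insert_le v A
      omega

lemma pp_class (h : Str F ρ d p a) {q : V × V} (hq : h.PP q) : a q.1 = a q.2 := by
  rcases hq with ⟨h0, h1⟩ | ⟨h0, h1⟩
  · rw [h1, (h.par _ h0).2.2]
  · rw [h1, (h.par _ h0).2.2]

lemma pp_swap (h : Str F ρ d p a) {u v : V} (hq : h.PP (u, v)) : h.PP (v, u) := Or.symm hq

open Classical in
lemma inner (h : Str F ρ d p a) (hno : ∀ A, Cyclic F A → 8 * ρ + 4 < A.card) {u v : V}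
    (huv : F.Adj u v) (ha : a u = a v) : h.PP (u, v) := by
  by_contra hpp
  obtain ⟨A, hA1, hA2, hA3, hA4⟩ := h.exists_anc _ u rfl
  obtain ⟨B, hB1, hB2, hB3, hB4⟩ := h.exists_anc _ v rfl
  have hc : Cyclic F (A ∪ B) := by
    refine h.cyclic ⟨u, by simp [hA1]⟩ ?_ {a u} ?_ (X := {(u, v), (v, u)}) ?_ ?_ ?_
    · intro x hx h0
      rcases Finset.mem_union.1 hx with hx | hx
      · exact Finset.mem_union_left _ (hA2 x hx h0)
      · exact Finset.mem_union_right _ (hB2 x hx h0)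
    · intro x hx
      rcases Finset.mem_union.1 hx with hx | hx
      · simp [hA3 x hx]
      · simp [hB3 x hx, ha]
    · intro q hq
      rw [mem_prs]
      simp only [Finset.mem_insert, Finset.mem_singleton] at hq
      rcases hq with rfl | rfl
      · simp [hA1, hB1, huv]
      · simp [hA1, hB1, huv.symm]
    · intro q hq
      simp only [Finset.mem_insert, Finset.mem_singleton] at hq
      rcases hq with rfl | rfl
      · exact hpp
      · exact fun h' => hpp (h.pp_swap h')
    · rw [Finset.card_pair]
      · simp
      · intro h'
        have := (Prod.mk.inj h').1
        subst this
        exact F.loopless.irrefl _ huv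
  have h1 := hno _ hc
  have h2 := Finset.card_union_le A B
  have := h.le u
  have := h.le v
  omega

open Classical in
lemma outer (h : Str F ρ d p a) (hno : ∀ A, Cyclic F A → 8 * ρ + 4 < A.card) {u v u' v' : V}
    (huv : F.Adj u v) (huv' : F.Adj u' v') (hu : a u = a u') (hv : a v = a v') (hne : a u ≠ a v) :
    (u, v) = (u', v') := by
  by_contra hneq
  obtain ⟨A, hA1, hA2, hA3, hA4⟩ := h.exists_anc _ u rfl
  obtain ⟨B, hB1, hB2, hB3, hB4⟩ := h.exists_anc _ v rfl
  obtain ⟨A', hA1', hA2', hA3', hA4'⟩ := h.exists_anc _ u' rfl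
  obtain ⟨B', hB1', hB2', hB3', hB4'⟩ := h.exists_anc _ v' rfl
  have hmem : ∀ x, x ∈ (A ∪ B) ∪ (A' ∪ B') ↔ (x ∈ A ∨ x ∈ B) ∨ (x ∈ A' ∨ x ∈ B') := by
    intro x; simp only [Finset.mem_union]
  have hc : Cyclic F ((A ∪ B) ∪ (A' ∪ B')) := by
    refine h.cyclic ⟨u, by simp [hA1]⟩ ?_ {a u, a v} ?_
      (X := {(u, v), (v, u), (u', v'), (v', u')}) ?_ ?_ ?_
    · intro x hx h0
      rw [hmem] at hx ⊢
      have h1 := hA2 x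
      have h2 := hB2 x
      have h3 := hA2' x
      have h4 := hB2' x
      tauto
    · intro x hx
      rw [hmem] at hx
      rcases hx with (hx | hx) | (hx | hx)
      · simp [hA3 x hx]
      · simp [hB3 x hx]
      · simp [hA3' x hx, hu]
      · simp [hB3' x hx, hv]
    · intro q hq
      rw [mem_prs, hmem, hmem]
      simp only [Finset.mem_insert, Finset.mem_singleton] at hq
      rcases hq with rfl | rfl | rfl | rfl
      · simp [hA1, hB1, huv]
      · simp [hA1, hB1, huv.symm]
      · simp [hA1', hB1', huv']
      · simp [hA1', hB1', huv'.symm]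
    · intro q hq hpp
      have := h.pp_class hpp
      simp only [Finset.mem_insert, Finset.mem_singleton] at hq
      rcases hq with rfl | rfl | rfl | rfl
      · exact hne this
      · exact hne this.symm
      · exact hne (by rw [hu, hv]; exact this)
      · exact hne (by rw [hu, hv]; exact this.symm)
    · have hauv : ∀ x y, a x ≠ a y → x ≠ y := fun x y hxy h' => hxy (by rw [h'])
      have hn1 : u ≠ v := hauv _ _ hne
      have hn2 : u ≠ v' := hauv _ _ (by rw [← hv]; exact hne)
      have hn3 : v ≠ u' := hauv _ _ (by rw [← hu]; exact hne.symm)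
      have hn4 : u' ≠ v' := hauv _ _ (by rw [← hu, ← hv]; exact hne)
      have h4 : ({(u, v), (v, u), (u', v'), (v', u')} : Finset (V × V)).card = 4 := by
        rw [Finset.card_insert_of_notMem, Finset.card_insert_of_notMem,
          Finset.card_insert_of_notMem, Finset.card_singleton]
        · simp [hn4]
        · simp only [Finset.mem_insert, Finset.mem_singleton, Prod.mk.injEq]
          simp only [Prod.mk.injEq] at hneq
          tauto
        · simp only [Finset.mem_insert, Finset.mem_singleton, Prod.mk.injEq]
          simp only [Prod.mk.injEq] at hneq
          tauto
      have h2 : ({a u, a v} : Finset V).card = 2 := Finset.card_pair hne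
      rw [h4, h2]
  have h1 := hno _ hc
  have h2 := Finset.card_union_le A B
  have h3 := Finset.card_union_le A' B'
  have h4 := Finset.card_union_le (A ∪ B) (A' ∪ B')
  have := h.le u
  have := h.le v
  have := h.le u'
  have := h.le v'
  omega

open Classical in
/-- Edges leaving a subset of a class. -/
lemma out [Fintype V] (h : Str F ρ d p a) (hno : ∀ A, Cyclic F A → 8 * ρ + 4 < A.card)
    {T : Finset V} {y : V} (hy : y ∈ T) (hy0 : d y = 0) (hT : ∀ v ∈ T, a v = y)
    (h3 : ∀ v ∈ T, 3 ≤ dg F Finset.univ v) :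
    T.card + 2 ≤ ((T ×ˢ (Finset.univ \ T)).filter (fun q => F.Adj q.1 q.2)).card := by
  have h1 : (prs F T).card ≤ 2 * (T.card - 1) := by
    have hsub : prs F T ⊆ (T.erase y).image (fun v => (v, p v)) ∪
        (T.erase y).image (fun v => (p v, v)) := by
      rintro ⟨u, v⟩ hq
      obtain ⟨⟨hu, hv⟩, huv⟩ := mem_prs.1 hq
      have := h.inner hno huv (by rw [hT _ hu, hT _ hv])
      rcases this with ⟨h0, e⟩ | ⟨h0, e⟩
      · refine Finset.mem_union_left _ (Finset.mem_image.2 ⟨u, ?_, ?_⟩)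
        · refine Finset.mem_erase.2 ⟨?_, hu⟩
          rintro rfl
          simp only at h0; omega
        · simp only at e; rw [e]
      · refine Finset.mem_union_right _ (Finset.mem_image.2 ⟨v, ?_, ?_⟩)
        · refine Finset.mem_erase.2 ⟨?_, hv⟩
          rintro rfl
          simp only at h0; omega
        · simp only at e; rw [e]
    have c1 := Finset.card_le_card hsub
    have c2 := Finset.card_union_le ((T.erase y).image (fun v => (v, p v)))
      ((T.erase y).image (fun v => (p v, v)))
    have c3 : ((T.erase y).image (fun v => (v, p v))).card ≤ _ := Finset.card_image_le
    have c4 : ((T.erase y).image (fun v => (p v, v))).card ≤ _ := Finset.card_image_le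
    have c5 := Finset.card_erase_of_mem hy
    omega
  have hsplit : ∀ v, dg F Finset.univ v = dg F T v + dg F (Finset.univ \ T) v := by
    intro v
    unfold dg
    rw [← Finset.card_union_of_disjoint, ← Finset.filter_union,
      Finset.union_sdiff_of_subset (Finset.subset_univ _)]
    exact Finset.disjoint_filter_filter Finset.disjoint_sdiff
  have hout : ((T ×ˢ (Finset.univ \ T)).filter (fun q => F.Adj q.1 q.2)).card =
      ∑ v ∈ T, dg F (Finset.univ \ T) v := by
    rw [Finset.card_filter, Finset.sum_product]
    apply Finset.sum_congr rfl
    intro v _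
    rw [dg, Finset.card_filter]
  have hsum : ∑ v ∈ T, dg F Finset.univ v = (prs F T).card + ∑ v ∈ T, dg F (Finset.univ \ T) v := by
    rw [prs_card_eq_sum, ← Finset.sum_add_distrib]
    exact Finset.sum_congr rfl fun v _ => hsplit v
  have hge : T.card * 3 ≤ ∑ v ∈ T, dg F Finset.univ v := by
    simpa using Finset.card_nsmul_le_sum T (dg F Finset.univ) 3 h3
  have : 0 < T.card := Finset.card_pos.2 ⟨y, hy⟩
  omega

open Classical in
lemma prefix_card [Fintype V] (h : Str F ρ d p a) (hno : ∀ A, Cyclic F A → 8 * ρ + 4 < A.card)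
    {y : V} (hy0 : d y = 0) (h3 : ∀ v, a v = y → 3 ≤ dg F Finset.univ v) (i : ℕ) (hi : i ≤ ρ) :
    2 ^ i ≤ (Finset.univ.filter (fun v => a v = y ∧ d v ≤ i)).card := by
  induction i with
  | zero =>
    rw [pow_zero]
    apply Finset.card_pos.2
    exact ⟨y, by simp [hy0, h.root y hy0]⟩
  | succ i ih =>
    have ih := ih (by omega)
    set T := Finset.univ.filter (fun v => a v = y ∧ d v ≤ i) with hT
    have hmT : ∀ v, v ∈ T ↔ a v = y ∧ d v ≤ i := fun v => by simp [hT]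
    have ho := h.out hno (T := T) (y := y) (by simp [hmT, hy0, h.root y hy0]) hy0
      (fun v hv => ((hmT v).1 hv).1) (fun v hv => h3 v ((hmT v).1 hv).1)
    set O := (T ×ˢ (Finset.univ \ T)).filter (fun q => F.Adj q.1 q.2) with hO
    have hmO : ∀ q, q ∈ O ↔ q.1 ∈ T ∧ q.2 ∉ T ∧ F.Adj q.1 q.2 := fun q => by
      simp [hO, and_assoc]
    have hprop : ∀ q ∈ O, a q.2 = y ∧ d q.2 ≤ i + 1 ∧ q.1 = p q.2 := by
      intro q hq
      obtain ⟨h1, h2, hadj⟩ := (hmO q).1 hq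
      rw [hmT] at h1 h2
      obtain ⟨h5, h6⟩ := h.near _ _ hadj (by omega)
      have h7 : a q.2 = y := by rw [h5]; exact h1.1
      refine ⟨h7, by omega, ?_⟩
      have hpp := h.inner hno hadj (by rw [h7]; exact h1.1)
      rcases hpp with ⟨h0, e⟩ | ⟨h0, e⟩
      · exfalso
        have := (h.par _ h0).2.1
        simp only at e h0 this
        rw [← e] at this
        exact h2 ⟨h7, by omega⟩
      · exact e
    have hcard : O.card ≤ ((Finset.univ.filter (fun v => a v = y ∧ d v ≤ i + 1)) \ T).card := by
      apply Finset.card_le_card_of_injOn Prod.snd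
      · intro q hq
        have h1 := hprop q hq
        have h2 := ((hmO q).1 hq).2.1
        have : q.2 ∈ (Finset.univ.filter (fun v => a v = y ∧ d v ≤ i + 1)) \ T := by
          rw [Finset.mem_sdiff]
          exact ⟨by simp [h1.1, h1.2.1], h2⟩
        exact this
      · intro q hq q' hq' e
        have h1 := (hprop q hq).2.2
        have h2 := (hprop q' hq').2.2
        rw [e, ← h2] at h1
        exact Prod.ext h1 e
    have hsub : T ⊆ Finset.univ.filter (fun v => a v = y ∧ d v ≤ i + 1) := by
      intro v hv
      obtain ⟨h1, h2⟩ := (hmT v).1 hv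
      simp only [Finset.mem_filter, Finset.mem_univ, true_and]
      exact ⟨h1, by omega⟩
    have := Finset.card_sdiff_add_card_eq_card hsub
    rw [pow_succ]
    omega

end Str

open Classical in
lemma q2 [Fintype V] {F : SimpleGraph V} {r ρ : ℕ}
    (h3 : ∀ v w, F.Adj v w → 3 ≤ dg F Finset.univ v) (hedge : ∃ u v, F.Adj u v)
    (hρ : 4 * r ≤ 2 ^ ρ) :
    (∃ C : Fin r → Finset V, (∀ i, Cyclic F (C i)) ∧ ∀ i j, i ≠ j → Disjoint (C i) (C j)) ∨
    ∃ A, Cyclic F A ∧ A.card ≤ 8 * ρ + 4 := by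
  by_cases hno : ∃ A, Cyclic F A ∧ A.card ≤ 8 * ρ + 4
  · exact Or.inr hno
  left
  push Not at hno
  obtain ⟨d, p, a, h⟩ := exists_str F ρ
  obtain ⟨Q, hQ⟩ : ∃ Q : SimpleGraph V, ∀ y z, Q.Adj y z ↔
      (y ≠ z ∧ ∃ u v, F.Adj u v ∧ a u = y ∧ a v = z) :=
    ⟨{ Adj := fun y z => y ≠ z ∧ ∃ u v, F.Adj u v ∧ a u = y ∧ a v = z
       symm := ⟨fun y z hyz => ⟨hyz.1.symm, by
        obtain ⟨u, v, h1, h2, h3⟩ := hyz.2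
        exact ⟨v, u, h1.symm, h3, h2⟩⟩⟩
       loopless := ⟨fun y hy => hy.1 rfl⟩ }, fun _ _ => Iff.rfl⟩
  set Y := Finset.univ.filter (fun y => d y = 0 ∧ ∃ w, F.Adj y w) with hY
  have hmY : ∀ y, y ∈ Y ↔ d y = 0 ∧ ∃ w, F.Adj y w := fun y => by simp [hY]
  -- nonisolated vertices have nonisolated roots
  have hiso : ∀ n v, d v = n → (∃ w, F.Adj v w) → a v ∈ Y := by
    intro n
    induction n with
    | zero =>
      intro v hv hw
      rw [h.root v hv]
      exact (hmY v).2 ⟨hv, hw⟩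
    | succ n ih =>
      intro v hv hw
      have h1 := h.par v (by omega)
      rw [← h1.2.2]
      exact ih _ (by omega) ⟨v, h1.1.symm⟩
  have hiso2 : ∀ v, a v ∈ Y → 3 ≤ dg F Finset.univ v := by
    intro v hv
    by_cases h0 : d v = 0
    · rw [h.root v h0] at hv
      obtain ⟨w, hw⟩ := ((hmY v).1 hv).2
      exact h3 v w hw
    · exact h3 v _ (h.par v (by omega)).1
  have hYne : Y.Nonempty := by
    obtain ⟨u, v, huv⟩ := hedge
    exact ⟨a u, hiso _ u rfl ⟨v, huv⟩⟩
  have hQd : ∀ y ∈ Y, 4 * r ≤ dg Q Y y := by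
    intro y hy
    have hy0 := ((hmY y).1 hy).1
    have h33 : ∀ v, a v = y → 3 ≤ dg F Finset.univ v := fun v hv => hiso2 v (by rw [hv]; exact hy)
    set T := Finset.univ.filter (fun v => a v = y) with hT
    have hmT : ∀ v, v ∈ T ↔ a v = y := fun v => by simp [hT]
    have ho := h.out hno (T := T) (y := y) (by simp [hmT, h.root y hy0]) hy0
      (fun v hv => (hmT v).1 hv) (fun v hv => h33 v ((hmT v).1 hv))
    have hpc := h.prefix_card hno hy0 h33 ρ le_rfl
    have hsub : (Finset.univ.filter (fun v => a v = y ∧ d v ≤ ρ)).card ≤ T.card := by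
      apply Finset.card_le_card
      intro v hv
      rw [hmT]
      exact (Finset.mem_filter.1 hv).2.1
    have : ((T ×ˢ (Finset.univ \ T)).filter (fun q => F.Adj q.1 q.2)).card ≤ dg Q Y y := by
      apply Finset.card_le_card_of_injOn (fun q => a q.2)
      · intro q hq
        have hq' : (q.1 ∈ T ∧ q.2 ∉ T) ∧ F.Adj q.1 q.2 := by simpa using hq
        obtain ⟨⟨h1, h2⟩, hadj⟩ := hq'
        rw [hmT] at h1 h2
        refine Finset.mem_coe.2 (Finset.mem_filter.2 ?_)
        refine ⟨hiso _ _ rfl ⟨q.1, hadj.symm⟩, (hQ _ _).2 ?_⟩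
        exact ⟨fun e => h2 e.symm, q.1, q.2, hadj, h1, rfl⟩
      · intro q hq q' hq' e
        have hq1 : (q.1 ∈ T ∧ q.2 ∉ T) ∧ F.Adj q.1 q.2 := by simpa using hq
        have hq1' : (q'.1 ∈ T ∧ q'.2 ∉ T) ∧ F.Adj q'.1 q'.2 := by simpa using hq'
        obtain ⟨⟨h1, h2⟩, hadj⟩ := hq1
        obtain ⟨⟨h1', h2'⟩, hadj'⟩ := hq1'
        rw [hmT] at h1 h2 h1' h2'
        exact h.outer hno hadj hadj' (by rw [h1, h1']) e (by rw [h1]; exact fun e' => h2 e'.symm)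
    omega
  obtain ⟨C, hC, hdis⟩ := q3 Q r Y hYne hQd
  refine ⟨fun i => Finset.univ.filter (fun v => a v ∈ C i), ?_, ?_⟩
  · intro i
    obtain ⟨hCY, hCne, hCc⟩ := hC i
    have hch : ∀ q : V × V, ∃ q' : V × V, q ∈ prs Q (C i) →
        F.Adj q'.1 q'.2 ∧ a q'.1 = q.1 ∧ a q'.2 = q.2 := by
      intro q
      by_cases hq : q ∈ prs Q (C i)
      · obtain ⟨u, v, h1, h2, h3⟩ := ((hQ _ _).1 (mem_prs.1 hq).2).2
        exact ⟨(u, v), fun _ => ⟨h1, h2, h3⟩⟩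
      · exact ⟨q, fun h' => absurd h' hq⟩
    choose f hf using hch
    refine h.cyclic ?_ ?_ (C i) ?_ (X := (prs Q (C i)).image f) ?_ ?_ ?_
    · obtain ⟨c, hc⟩ := hCne
      refine ⟨c, ?_⟩
      simp only [Finset.mem_filter, Finset.mem_univ, true_and]
      rw [h.root c ((hmY c).1 (hCY hc)).1]
      exact hc
    · intro v hv h0
      simp only [Finset.mem_filter, Finset.mem_univ, true_and] at hv ⊢
      rw [(h.par v h0).2.2]
      exact hv
    · intro v hv
      simpa using hv
    · intro q hq
      obtain ⟨q0, hq0, rfl⟩ := Finset.mem_image.1 hq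
      obtain ⟨h1, h2, h3⟩ := hf q0 hq0
      have hm := (mem_prs.1 hq0).1
      rw [mem_prs]
      simp only [Finset.mem_filter, Finset.mem_univ, true_and]
      exact ⟨⟨by rw [h2]; exact hm.1, by rw [h3]; exact hm.2⟩, h1⟩
    · intro q hq hpp
      obtain ⟨q0, hq0, rfl⟩ := Finset.mem_image.1 hq
      obtain ⟨h1, h2, h3⟩ := hf q0 hq0
      have := h.pp_class hpp
      rw [h2, h3] at this
      exact ((hQ _ _).1 (mem_prs.1 hq0).2).1 this
    · rw [Finset.card_image_of_injOn]
      · exact hCc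
      · intro q hq q' hq' e
        obtain ⟨h1, h2, h3⟩ := hf q hq
        obtain ⟨h1', h2', h3'⟩ := hf q' hq'
        rw [e] at h2 h3
        exact Prod.ext (h2.symm.trans h2') (h3.symm.trans h3')
  · intro i j hij
    rw [Finset.disjoint_left]
    intro v hv hv'
    simp only [Finset.mem_filter, Finset.mem_univ, true_and] at hv hv'
    exact Finset.disjoint_left.1 (hdis i j hij) hv hv'

open Classical in
lemma star_aux [Fintype V] {r ρ : ℕ} (hρ : 4 * r ≤ 2 ^ ρ) (n : ℕ) :
    ∀ F : SimpleGraph V, (Finset.univ.filter (fun v => dg F Finset.univ v = 2)).card = n →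
    (∀ v, dg F Finset.univ v ≠ 1) → (∃ u v, F.Adj u v) →
    (∃ C : Fin r → Finset V, (∀ i, Cyclic F (C i)) ∧ ∀ i j, i ≠ j → Disjoint (C i) (C j)) ∨
    ∃ A, Cyclic F A ∧ (A.filter (fun v => 3 ≤ dg F Finset.univ v)).card ≤ 8 * ρ + 4 := by
  induction n with
  | zero =>
    intro F hn h1 hedge
    rw [Finset.card_eq_zero] at hn
    have h2 : ∀ v, dg F Finset.univ v ≠ 2 := by
      intro v hv
      have : v ∈ Finset.univ.filter (fun v => dg F Finset.univ v = 2) := by simp [hv]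
      rw [hn] at this
      simp at this
    have h3 : ∀ v w, F.Adj v w → 3 ≤ dg F Finset.univ v := by
      intro v w hvw
      have : 0 < dg F Finset.univ v := Finset.card_pos.2 ⟨w, by simp [hvw]⟩
      have := h1 v
      have := h2 v
      omega
    rcases q2 h3 hedge hρ with h | ⟨A, hA, hAc⟩
    · exact Or.inl h
    · exact Or.inr ⟨A, hA, (Finset.card_filter_le _ _).trans hAc⟩
  | succ n ih =>
    intro F hn h1 hedge
    obtain ⟨v, hv⟩ := Finset.card_pos.1 (show 0 < _ by rw [hn]; omega)
    have hv2 : dg F Finset.univ v = 2 := by simpa using hv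
    obtain ⟨u, w, huw, hN⟩ := Finset.card_eq_two.1 (show (Finset.univ.filter (fun x => F.Adj v x)).card = 2 from hv2)
    have hmN : ∀ x, F.Adj v x ↔ x = u ∨ x = w := by
      intro x
      have : x ∈ Finset.univ.filter (fun x => F.Adj v x) ↔ x ∈ ({u, w} : Finset V) := by rw [hN]
      simpa using this
    have hvu : F.Adj v u := (hmN u).2 (Or.inl rfl)
    have hvw : F.Adj v w := (hmN w).2 (Or.inr rfl)
    have huv : u ≠ v := hvu.ne'
    have hwv : w ≠ v := hvw.ne'
    by_cases hadj : F.Adj u w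
    · right
      refine ⟨{u, v, w}, ⟨⟨u, by simp⟩, ?_⟩, ?_⟩
      · have hc : ({u, v, w} : Finset V).card = 3 := by
          rw [Finset.card_insert_of_notMem, Finset.card_pair]
          · exact hwv.symm
          · simp [huv, huw]
        rw [hc]
        have hsub : ({(u, v), (v, u), (u, w), (w, u), (v, w), (w, v)} : Finset (V × V)) ⊆
            prs F {u, v, w} := by
          intro q hq
          simp only [Finset.mem_insert, Finset.mem_singleton] at hq
          rw [mem_prs]
          rcases hq with rfl | rfl | rfl | rfl | rfl | rfl
          · simp [hvu.symm]
          · simp [hvu]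
          · simp [hadj]
          · simp [hadj.symm]
          · simp [hvw]
          · simp [hvw.symm]
        have h6 : ({(u, v), (v, u), (u, w), (w, u), (v, w), (w, v)} : Finset (V × V)).card = 6 := by
          rw [Finset.card_insert_of_notMem, Finset.card_insert_of_notMem,
            Finset.card_insert_of_notMem, Finset.card_insert_of_notMem,
            Finset.card_insert_of_notMem, Finset.card_singleton]
          all_goals
            simp only [Finset.mem_insert, Finset.mem_singleton, Prod.mk.injEq]
            grind
        have := Finset.card_le_card hsub
        omega
      · have h3 : ({u, v, w} : Finset V).card ≤ 3 := Finset.card_le_three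
        have := Finset.card_filter_le ({u, v, w} : Finset V) (fun v => 3 ≤ dg F Finset.univ v)
        omega
    obtain ⟨F', hF'⟩ : ∃ F' : SimpleGraph V, ∀ x y, F'.Adj x y ↔
        ((F.Adj x y ∧ x ≠ v ∧ y ≠ v) ∨ (x = u ∧ y = w) ∨ (x = w ∧ y = u)) :=
      ⟨{ Adj := fun x y => (F.Adj x y ∧ x ≠ v ∧ y ≠ v) ∨ (x = u ∧ y = w) ∨ (x = w ∧ y = u)
         symm := ⟨fun x y h => by
          rcases h with ⟨h, h2, h3⟩ | h | h
          · exact Or.inl ⟨h.symm, h3, h2⟩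
          · exact Or.inr (Or.inr ⟨h.2, h.1⟩)
          · exact Or.inr (Or.inl ⟨h.2, h.1⟩)⟩
         loopless := ⟨fun x h => by
          rcases h with ⟨h, -⟩ | ⟨h, h'⟩ | ⟨h, h'⟩
          · exact F.loopless.irrefl _ h
          · exact huw (h.symm.trans h')
          · exact huw (h'.symm.trans h)⟩ }, fun _ _ => Iff.rfl⟩
    have hdv : ∀ A, dg F' A v = 0 := by
      intro A
      rw [dg, Finset.card_eq_zero, Finset.filter_eq_empty_iff]
      intro x _ h
      rcases (hF' _ _).1 h with h | h | h
      · exact h.2.1 rfl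
      · exact huv h.1.symm
      · exact hwv h.1.symm
    have hdx : ∀ x, x ≠ v → dg F' Finset.univ x = dg F Finset.univ x := by
      intro x hx
      have hsw : ∀ u w : V, u ≠ w → F.Adj v u → (∀ x, F.Adj v x ↔ x = u ∨ x = w) → ¬ F.Adj u w → u ≠ v → w ≠ v →
          (∀ x y, F'.Adj x y ↔
            ((F.Adj x y ∧ x ≠ v ∧ y ≠ v) ∨ (x = u ∧ y = w) ∨ (x = w ∧ y = u))) →
          dg F' Finset.univ u = dg F Finset.univ u := by
        intro u w huw hvu hmN hadj huv hwv hF'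
        have : Finset.univ.filter (fun y => F'.Adj u y) =
            insert w ((Finset.univ.filter (fun y => F.Adj u y)).erase v) := by
          ext y
          simp only [Finset.mem_filter, Finset.mem_univ, true_and, Finset.mem_insert,
            Finset.mem_erase, hF']
          grind
        unfold dg
        rw [this, Finset.card_insert_of_notMem, Finset.card_erase_of_mem]
        · have : 0 < (Finset.univ.filter (fun y => F.Adj u y)).card :=
            Finset.card_pos.2 ⟨v, by simp [hvu.symm]⟩
          omega
        · simp [hvu.symm]
        · simp [hadj]
      by_cases hxu : x = u
      · subst hxu
        exact hsw x w huw hvu hmN hadj huv hwv hF'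
      by_cases hxw : x = w
      · subst hxw
        exact hsw x u huw.symm hvw (fun y => by rw [hmN y, or_comm]) (fun h => hadj h.symm) hwv huv
          (fun y z => by rw [hF' y z, or_comm (a := y = u ∧ z = x)])
      unfold dg
      congr 1
      ext y
      simp only [Finset.mem_filter, Finset.mem_univ, true_and, hF']
      have := hmN x
      have h2 := F.adj_comm x v
      constructor
      · rintro (h | h | h)
        · exact h.1
        · exact absurd h.1 hxu
        · exact absurd h.1 hxw
      · intro h
        refine Or.inl ⟨h, hx, ?_⟩
        rintro rfl
        rcases this.1 h.symm with h | h
        · exact hxu h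
        · exact hxw h
    have hlift : ∀ A, Cyclic F' A → ∃ B, Cyclic F B ∧ B ⊆ insert v A ∧ (v ∈ B → u ∈ A) := by
      rintro A ⟨hne, hc⟩
      have e1 : (prs F' (A.erase v)).card = (prs F' A).card := by
        by_cases hvA : v ∈ A
        · have := prs_erase (F := F') hvA
          rw [hdv] at this
          omega
        · rw [Finset.erase_eq_of_notMem hvA]
      have e2 : (A.erase v).card ≤ A.card := Finset.card_erase_le
      have hne' : (A.erase v).Nonempty := by
        have : 0 < A.card := Finset.card_pos.2 hne
        have : 0 < (prs F' (A.erase v)).card := by omega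
        obtain ⟨q, hq⟩ := Finset.card_pos.1 this
        exact ⟨q.1, (mem_prs.1 hq).1.1⟩
      by_cases hb : u ∈ A ∧ w ∈ A
      · refine ⟨insert v (A.erase v), ⟨⟨v, by simp⟩, ?_⟩, ?_, fun _ => hb.1⟩
        · rw [prs_insert (Finset.notMem_erase v A),
            Finset.card_insert_of_notMem (Finset.notMem_erase v A)]
          have hd2 : 2 ≤ dg F (A.erase v) v := by
            have : ({u, w} : Finset V) ⊆ (A.erase v).filter (fun x => F.Adj v x) := by
              intro x hx
              simp only [Finset.mem_insert, Finset.mem_singleton] at hx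
              rcases hx with rfl | rfl
              · simp [huv, hb.1, hvu]
              · simp [hwv, hb.2, hvw]
            have := Finset.card_le_card this
            rwa [Finset.card_pair huw] at this
          have hsub : prs F' (A.erase v) ⊆ prs F (A.erase v) ∪ {(u, w), (w, u)} := by
            rintro ⟨x, y⟩ hq
            obtain ⟨h1, h2⟩ := mem_prs.1 hq
            rcases (hF' _ _).1 h2 with h | h | h
            · exact Finset.mem_union_left _ (mem_prs.2 ⟨h1, h.1⟩)
            · apply Finset.mem_union_right; simp only at h; simp [h.1, h.2]
            · apply Finset.mem_union_right; simp only at h; simp [h.1, h.2]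
          have c1 := Finset.card_le_card hsub
          have c2 := Finset.card_union_le (prs F (A.erase v)) {(u, w), (w, u)}
          have c3 : ({(u, w), (w, u)} : Finset (V × V)).card ≤ 2 := Finset.card_le_two
          omega
        · exact Finset.insert_subset_insert _ (Finset.erase_subset _ _)
      · refine ⟨A.erase v, ⟨hne', ?_⟩, ?_, fun h => absurd h (Finset.notMem_erase v A)⟩
        · have hsub : prs F' (A.erase v) ⊆ prs F (A.erase v) := by
            rintro ⟨x, y⟩ hq
            obtain ⟨h1, h2⟩ := mem_prs.1 hq
            have h3 := Finset.mem_of_mem_erase h1.1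
            have h4 := Finset.mem_of_mem_erase h1.2
            rcases (hF' _ _).1 h2 with h | h | h
            · exact mem_prs.2 ⟨h1, h.1⟩
            · simp only at h h3 h4
              rw [h.1] at h3; rw [h.2] at h4
              exact absurd ⟨h3, h4⟩ hb
            · simp only at h h3 h4
              rw [h.1] at h3; rw [h.2] at h4
              exact absurd ⟨h4, h3⟩ hb
          have c1 := Finset.card_le_card hsub
          omega
        · exact (Finset.erase_subset _ _).trans (Finset.subset_insert _ _)
    have hcard : (Finset.univ.filter (fun x => dg F' Finset.univ x = 2)).card = n := by
      have : Finset.univ.filter (fun x => dg F' Finset.univ x = 2) =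
          (Finset.univ.filter (fun x => dg F Finset.univ x = 2)).erase v := by
        ext x
        simp only [Finset.mem_filter, Finset.mem_univ, true_and, Finset.mem_erase]
        by_cases hx : x = v
        · subst hx; simp [hdv]
        · simp [hx, hdx x hx]
      rw [this, Finset.card_erase_of_mem hv, hn]
      rfl
    have := ih F' hcard (by
      intro x
      by_cases hx : x = v
      · subst hx; simp [hdv]
      · rw [hdx x hx]; exact h1 x) ⟨u, w, (hF' _ _).2 (Or.inr (Or.inl ⟨rfl, rfl⟩))⟩
    rcases this with ⟨C, hC, hdis⟩ | ⟨A, hA, hAc⟩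
    · left
      choose B hB1 hB2 hB3 using fun i => hlift (C i) (hC i)
      refine ⟨B, hB1, ?_⟩
      intro i j hij
      rw [Finset.disjoint_left]
      intro x hxi hxj
      have hd := Finset.disjoint_left.1 (hdis i j hij)
      by_cases hx : x = v
      · subst hx
        exact hd (hB3 i hxi) (hB3 j hxj)
      · have h4 := hB2 i hxi
        have h5 := hB2 j hxj
        rw [Finset.mem_insert] at h4 h5
        exact hd (h4.resolve_left hx) (h5.resolve_left hx)
    · right
      obtain ⟨B, hB1, hB2, hB3⟩ := hlift A hA
      refine ⟨B, hB1, le_trans (Finset.card_le_card ?_) hAc⟩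
      intro x hx
      rw [Finset.mem_filter] at hx ⊢
      by_cases hxv : x = v
      · subst hxv
        omega
      · rw [hdx x hxv]
        exact ⟨(Finset.mem_insert.1 (hB2 hx.1)).resolve_left hxv, hx.2⟩

open Classical in
lemma star [Fintype V] {r ρ : ℕ} (hρ : 4 * r ≤ 2 ^ ρ) (F : SimpleGraph V)
    (h1 : ∀ v w, F.Adj v w → ∃ w', w' ≠ w ∧ F.Adj v w') (hedge : ∃ u v, F.Adj u v) :
    (∃ C : Fin r → Finset V, (∀ i, Cyclic F (C i)) ∧ ∀ i j, i ≠ j → Disjoint (C i) (C j)) ∨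
    ∃ A, Cyclic F A ∧ (A.filter (fun v => 3 ≤ dg F Finset.univ v)).card ≤ 8 * ρ + 4 := by
  refine star_aux hρ _ F rfl ?_ hedge
  intro v hv
  obtain ⟨w, hw⟩ := Finset.card_eq_one.1 (show (Finset.univ.filter (fun x => F.Adj v x)).card = 1 from hv)
  have hmem : ∀ x, F.Adj v x ↔ x = w := by
    intro x
    have : x ∈ Finset.univ.filter (fun x => F.Adj v x) ↔ x ∈ ({w} : Finset V) := by rw [hw]
    simpa using this
  obtain ⟨w', hne, hadj⟩ := h1 v w ((hmem w).2 rfl)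
  exact hne ((hmem w').1 hadj)

def Gir (F : SimpleGraph V) (ℓ : ℕ) : Prop :=
  ∀ u v, F.Adj u v → ∀ p : (F.deleteEdges {s(u,v)}).Walk u v, ℓ ≤ p.length + 1

/-- Walks in a graph with one extra edge split into walks avoiding that edge. -/
lemma walk_split {K K0 : SimpleGraph V} {x y : V}
    (hK : ∀ a b, K.Adj a b → K0.Adj a b ∨ (a = x ∧ b = y) ∨ (a = y ∧ b = x))
    {u v : V} (w : K.Walk u v) :
    (∃ p : K0.Walk u v, p.length ≤ w.length) ∨
    (∃ (p : K0.Walk u x) (q : K0.Walk y v), p.length + q.length + 1 ≤ w.length) ∨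
    (∃ (p : K0.Walk u y) (q : K0.Walk x v), p.length + q.length + 1 ≤ w.length) := by
  induction w with
  | nil => exact Or.inl ⟨Walk.nil, by simp⟩
  | @cons a b c h w ih =>
    rcases hK _ _ h with h0 | ⟨rfl, rfl⟩ | ⟨rfl, rfl⟩
    · rcases ih with ⟨p, hp⟩ | ⟨p, q, hp⟩ | ⟨p, q, hp⟩
      · exact Or.inl ⟨Walk.cons h0 p, by simp; omega⟩
      · exact Or.inr (Or.inl ⟨Walk.cons h0 p, q, by simp; omega⟩)
      · exact Or.inr (Or.inr ⟨Walk.cons h0 p, q, by simp; omega⟩)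
    · rcases ih with ⟨p, hp⟩ | ⟨p, q, hp⟩ | ⟨p, q, hp⟩
      · exact Or.inr (Or.inl ⟨Walk.nil, p, by simp; omega⟩)
      · exact Or.inr (Or.inl ⟨Walk.nil, q, by simp; omega⟩)
      · exact Or.inl ⟨q, by simp; omega⟩
    · rcases ih with ⟨p, hp⟩ | ⟨p, q, hp⟩ | ⟨p, q, hp⟩
      · exact Or.inr (Or.inr ⟨Walk.nil, p, by simp; omega⟩)
      · exact Or.inl ⟨q, by simp; omega⟩
      · exact Or.inr (Or.inr ⟨Walk.nil, q, by simp; omega⟩)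

lemma Gir.addEdge {F F' : SimpleGraph V} {ℓ : ℕ} {x y : V} (hF : Gir F ℓ)
    (hF' : ∀ a b, F'.Adj a b ↔ F.Adj a b ∨ (a = x ∧ b = y) ∨ (a = y ∧ b = x))
    (h : ∀ p : F.Walk x y, ℓ ≤ p.length + 1) : Gir F' ℓ := by
  intro u v huv w
  by_cases he : s(u,v) = s(x,y)
  · have hle : F'.deleteEdges {s(u,v)} ≤ F := by
      intro a b hab
      rw [deleteEdges_adj, hF'] at hab
      rcases hab with ⟨h1 | ⟨rfl, rfl⟩ | ⟨rfl, rfl⟩, h2⟩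
      · exact h1
      · exact absurd (by simp [he]) h2
      · exact absurd (by simp [he]) h2
    rcases Sym2.eq_iff.1 he with ⟨rfl, rfl⟩ | ⟨rfl, rfl⟩
    · simpa using h (w.mapLe hle)
    · simpa using h (w.mapLe hle).reverse
  · have huvF : F.Adj u v := by
      rcases (hF' _ _).1 huv with h1 | ⟨rfl, rfl⟩ | ⟨rfl, rfl⟩
      · exact h1
      · exact absurd rfl he
      · exact absurd Sym2.eq_swap he
    have hs := walk_split (K := F'.deleteEdges {s(u,v)}) (K0 := F.deleteEdges {s(u,v)}) (x := x) (y := y)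
      (by
        intro a b hab
        rw [deleteEdges_adj, hF'] at hab
        rcases hab with ⟨h1 | h1, h2⟩
        · exact Or.inl (deleteEdges_adj.2 ⟨h1, h2⟩)
        · exact Or.inr h1) w
    have hle : F.deleteEdges {s(u,v)} ≤ F := deleteEdges_le _
    rcases hs with ⟨p, hp⟩ | ⟨p, q, hp⟩ | ⟨p, q, hp⟩
    · have := hF u v huvF p
      omega
    · have := h (((p.mapLe hle).reverse.concat huvF).append (q.mapLe hle).reverse)
      simp at this
      omega
    · have := h ((q.mapLe hle).append (Walk.cons huvF.symm (p.mapLe hle)))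
      simp at this
      omega

def chain (F : SimpleGraph V) (g : ℕ → V) (k : ℕ) : SimpleGraph V where
  Adj u v := F.Adj u v ∨ (u ≠ v ∧ ∃ i < k, (u = g i ∧ v = g (i+1)) ∨ (u = g (i+1) ∧ v = g i))
  symm := ⟨by
    rintro u v (h | ⟨h, i, hi, h1⟩)
    · exact Or.inl h.symm
    · exact Or.inr ⟨h.symm, i, hi, by tauto⟩⟩
  loopless := ⟨by
    rintro u (h | ⟨h, -⟩)
    · exact F.loopless.irrefl _ h
    · exact h rfl⟩

lemma chain_le (F : SimpleGraph V) (g : ℕ → V) (k : ℕ) : F ≤ chain F g k := fun _ _ h => Or.inl h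

lemma chain_succ {F : SimpleGraph V} {g : ℕ → V} {k : ℕ} {ℓ : ℕ} (h : Gir (chain F g k) ℓ)
    (hne : g k ≠ g (k+1))
    (hw : ∀ p : (chain F g k).Walk (g k) (g (k+1)), ℓ ≤ p.length + 1) :
    Gir (chain F g (k+1)) ℓ := by
  refine h.addEdge (x := g k) (y := g (k+1)) ?_ hw
  intro a b
  constructor
  · rintro (h | ⟨h, i, hi, h1⟩)
    · exact Or.inl (Or.inl h)
    · rcases Nat.lt_succ_iff_lt_or_eq.1 hi with hi | rfl
      · exact Or.inl (Or.inr ⟨h, i, hi, h1⟩)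
      · exact Or.inr h1
  · rintro ((h | ⟨h, i, hi, h1⟩) | h1)
    · exact Or.inl h
    · exact Or.inr ⟨h, i, by omega, h1⟩
    · refine Or.inr ⟨?_, k, by omega, h1⟩
      rcases h1 with ⟨rfl, rfl⟩ | ⟨rfl, rfl⟩
      · exact hne
      · exact hne.symm

lemma chain_gir {F : SimpleGraph V} {g : ℕ → V} {n : ℕ} {ℓ : ℕ} (h : Gir F ℓ)
    (hinj : ∀ i < n, ∀ j < n, g i = g j → i = j)
    (hiso : ∀ i < n, 0 < i → g i ∉ F.support) :
    ∀ k < n, Gir (chain F g k) ℓ := by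
  intro k
  induction k with
  | zero =>
    intro _
    have : chain F g 0 = F := by
      ext u v; simp [chain]
    rwa [this]
  | succ k ih =>
    intro hk
    have hne : g k ≠ g (k+1) := fun he => by
      have := hinj _ (by omega) _ hk he
      omega
    refine chain_succ (ih (by omega)) hne ?_
    intro p
    exfalso
    have hp : ¬ p.Nil := fun hn => hne hn.eq
    have h1 := p.adj_penultimate hp
    rcases h1 with h1 | ⟨-, i, hi, ⟨-, h1⟩ | ⟨-, h1⟩⟩
    · exact hiso _ hk (by omega) ⟨_, h1.symm⟩
    · have := hinj _ hk _ (by omega) h1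
      omega
    · have := hinj _ hk _ (by omega) h1
      omega

/-- Maps that send edges to edges or points send walks to walks that are no longer. -/
lemma walk_map {K K0 : SimpleGraph V} (π : V → V)
    (hπ : ∀ a b, K.Adj a b → π a = π b ∨ K0.Adj (π a) (π b)) {u v : V} (w : K.Walk u v) :
    ∃ p : K0.Walk (π u) (π v), p.length ≤ w.length := by
  induction w with
  | nil => exact ⟨Walk.nil, by simp⟩
  | cons h w ih =>
    obtain ⟨p, hp⟩ := ih
    rcases hπ _ _ h with h1 | h1
    · rw [h1]; exact ⟨p, by simp; omega⟩
    · exact ⟨Walk.cons h1 p, by simp; omega⟩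

/-- Adding an ear. -/
lemma ear_gir {F : SimpleGraph V} {g : ℕ → V} {n : ℕ} {ℓ : ℕ} (h : Gir F ℓ) (hn : 1 ≤ n)
    (hinj : ∀ i ≤ n, ∀ j ≤ n, g i = g j → i = j)
    (hiso : ∀ i < n, 0 < i → g i ∉ F.support)
    (hfar : ∀ p : F.Walk (g 0) (g n), ℓ ≤ p.length + 1) : Gir (chain F g n) ℓ := by
  classical
  obtain ⟨k, rfl⟩ : ∃ k, n = k + 1 := ⟨n - 1, by omega⟩
  have h0 := chain_gir h (n := k+1) (fun i hi j hj => hinj i hi.le j hj.le) hiso k (by omega)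
  refine chain_succ h0 (fun he => by have := hinj _ (by omega) _ le_rfl he; omega) ?_
  intro w
  obtain ⟨p, hp⟩ := walk_map (K0 := F) (fun v => if ∃ i, i ≤ k ∧ v = g i then g 0 else v) (by
    rintro a b (hab | ⟨-, i, hi, ⟨rfl, rfl⟩ | ⟨rfl, rfl⟩⟩)
    · right
      have key : ∀ a b, F.Adj a b → (if ∃ i, i ≤ k ∧ a = g i then g 0 else a) = a := by
        intro a b hab
        split_ifs with ha
        · obtain ⟨i, hi, rfl⟩ := ha
          rcases Nat.eq_zero_or_pos i with rfl | hi0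
          · rfl
          · exact absurd ⟨_, hab⟩ (hiso i (by omega) hi0)
        · rfl
      simp only [key a b hab, key b a hab.symm]
      exact hab
    · left
      rw [if_pos ⟨i, hi.le, rfl⟩, if_pos ⟨i+1, hi, rfl⟩]
    · left
      rw [if_pos ⟨i+1, hi, rfl⟩, if_pos ⟨i, hi.le, rfl⟩]) w
  have e1 : (if ∃ i, i ≤ k ∧ g k = g i then g 0 else g k) = g 0 := if_pos ⟨k, le_rfl, rfl⟩
  have e2 : (if ∃ i, i ≤ k ∧ g (k+1) = g i then g 0 else g (k+1)) = g (k+1) := if_neg (by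
    rintro ⟨i, hi, h⟩
    have := hinj _ le_rfl _ (by omega) h
    omega)
  have := hfar (p.copy e1 e2)
  simp at this
  omega

/-- Adding a cycle. -/
lemma cyc_gir {F : SimpleGraph V} {g : ℕ → V} {m : ℕ} {ℓ : ℕ} (h : Gir F ℓ) (hm : 3 ≤ m)
    (hinj : ∀ i < m, ∀ j < m, g i = g j → i = j) (hg : g m = g 0)
    (hiso : ∀ i < m, g i ∉ F.support) (hℓ : ℓ ≤ m) : Gir (chain F g m) ℓ := by
  obtain ⟨k, rfl⟩ : ∃ k, m = k + 1 := ⟨m - 1, by omega⟩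
  have h0 := chain_gir h (n := k+1) hinj (fun i hi _ => hiso i hi) k (by omega)
  refine chain_succ h0 (fun he => by
    rw [hg] at he
    have := hinj _ (by omega) _ (by omega) he; omega) ?_
  intro w
  have key : ∀ u v (w : (chain F g k).Walk u v), ∀ i ≤ k, u = g i → ∃ j ≤ k, v = g j ∧ i ≤ j + w.length := by
    intro u v w
    induction w with
    | nil => intro i hi hu; exact ⟨i, hi, hu, by simp⟩
    | cons hab w ih =>
      rintro i hi rfl
      rw [Walk.length_cons]
      have hab' := hab
      rcases hab' with h1 | ⟨-, j, hj, ⟨h1, rfl⟩ | ⟨h1, rfl⟩⟩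
      · exact absurd ⟨_, h1⟩ (hiso i (by omega))
      · obtain ⟨j', h3, h4, h5⟩ := ih (j+1) (by omega) rfl
        have := hinj _ (by omega) _ (by omega) h1
        exact ⟨j', h3, h4, by omega⟩
      · obtain ⟨j', h3, h4, h5⟩ := ih j (by omega) rfl
        have := hinj _ (by omega) _ (by omega) h1
        exact ⟨j', h3, h4, by omega⟩
  obtain ⟨j, h1, h2, h3⟩ := key _ _ w k le_rfl rfl
  rw [hg] at h2
  have := hinj _ (by omega) _ (by omega) h2
  omega

def NoLeaf (F : SimpleGraph V) : Prop := ∀ v w, F.Adj v w → ∃ w', w' ≠ w ∧ F.Adj v w'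

lemma chain_noLeaf {F : SimpleGraph V} {g : ℕ → V} {n : ℕ} (hF : NoLeaf F)
    (h : ∀ i ≤ n, ∀ w, (chain F g n).Adj (g i) w → ∃ w', w' ≠ w ∧ (chain F g n).Adj (g i) w') :
    NoLeaf (chain F g n) := by
  intro v w hvw
  have hvw' := hvw
  rcases hvw' with h1 | ⟨-, i, hi, ⟨rfl, h1⟩ | ⟨rfl, h1⟩⟩
  · obtain ⟨w', h2, h3⟩ := hF v w h1
    exact ⟨w', h2, Or.inl h3⟩
  · exact h i hi.le w hvw
  · exact h (i+1) hi w hvw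

lemma noLeaf_two {F : SimpleGraph V} (hF : NoLeaf F) {x : V} (hx : x ∈ F.support) (w : V) :
    ∃ w', w' ≠ w ∧ F.Adj x w' := by
  obtain ⟨a, ha⟩ := hx
  obtain ⟨b, hb, hb'⟩ := hF _ _ ha
  by_cases h : a = w
  · exact ⟨b, h ▸ hb, hb'⟩
  · exact ⟨a, h, ha⟩

/-- Existence of the maximal subgraph together with its ear properties. -/
lemma exists_max [Fintype V] (G : SimpleGraph V) (ℓ : ℕ) :
    ∃ F : SimpleGraph V, F ≤ G ∧ Gir F ℓ ∧ NoLeaf F ∧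
      ∀ F', F ≤ F' → F' ≤ G → Gir F' ℓ → NoLeaf F' → F' = F := by
  classical
  have hfin : {F : SimpleGraph V | F ≤ G ∧ Gir F ℓ ∧ NoLeaf F}.Finite := Set.toFinite _
  have hne : {F : SimpleGraph V | F ≤ G ∧ Gir F ℓ ∧ NoLeaf F}.Nonempty :=
    ⟨⊥, bot_le, fun u v h => by simp at h, fun u v h => by simp at h⟩
  obtain ⟨F, hF⟩ := hfin.exists_maximal hne
  refine ⟨F, hF.1.1, hF.1.2.1, hF.1.2.2, ?_⟩
  intro F' h1 h2 h3 h4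
  exact le_antisymm (hF.2 ⟨h2, h3, h4⟩ h1) h1

lemma max_ear {F G : SimpleGraph V} {ℓ : ℕ} (hFG : F ≤ G) (hgir : Gir F ℓ) (hnl : NoLeaf F)
    (hmax : ∀ F', F ≤ F' → F' ≤ G → Gir F' ℓ → NoLeaf F' → F' = F)
    {g : ℕ → V} {n : ℕ} (hn : 1 ≤ n)
    (hinj : ∀ i ≤ n, ∀ j ≤ n, g i = g j → i = j)
    (hadj : ∀ i < n, G.Adj (g i) (g (i+1)))
    (hiso : ∀ i < n, 0 < i → g i ∉ F.support) (hx : g 0 ∈ F.support) (hy : g n ∈ F.support)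
    (hnew : ¬ F.Adj (g 0) (g 1)) : ∃ p : F.Walk (g 0) (g n), p.length < ℓ := by
  by_contra hcon
  push Not at hcon
  have hg := ear_gir hgir hn hinj hiso (fun p => (hcon p).trans (by omega))
  have hc : ∀ i < n, (chain F g n).Adj (g i) (g (i+1)) := fun i hi =>
    Or.inr ⟨(hadj i hi).ne, i, hi, Or.inl ⟨rfl, rfl⟩⟩
  have heq := hmax _ (chain_le F g n) (by
    rintro u v (h | ⟨-, i, hi, ⟨rfl, rfl⟩ | ⟨rfl, rfl⟩⟩)
    · exact hFG h
    · exact hadj i hi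
    · exact (hadj i hi).symm) hg (chain_noLeaf hnl (by
      intro i hi w hw
      by_cases hs : g i ∈ F.support
      · obtain ⟨w', h1, h2⟩ := noLeaf_two hnl hs w
        exact ⟨w', h1, Or.inl h2⟩
      · have h0 : i ≠ 0 := by rintro rfl; exact hs hx
        have h1 : i ≠ n := by rintro rfl; exact hs hy
        obtain ⟨j, rfl⟩ : ∃ j, i = j + 1 := ⟨i - 1, by omega⟩
        by_cases hw : w = g j
        · refine ⟨g (j+2), fun h => ?_, hc (j+1) (by omega)⟩
          have := hinj _ (by omega) _ (by omega) (h.trans hw)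
          omega
        · exact ⟨g j, fun h => hw h.symm, (hc j (by omega)).symm⟩))
  apply hnew
  rw [← heq]
  exact hc 0 (by omega)

lemma max_cyc {F G : SimpleGraph V} {ℓ : ℕ} (hFG : F ≤ G) (hgir : Gir F ℓ) (hnl : NoLeaf F)
    (hmax : ∀ F', F ≤ F' → F' ≤ G → Gir F' ℓ → NoLeaf F' → F' = F)
    {g : ℕ → V} {m : ℕ} (hcyc : IsCyc G m g) (hiso : ∀ i < m, g i ∉ F.support) : m < ℓ := by
  by_contra hcon
  push Not at hcon
  obtain ⟨hm, hinj, hadj, hgm⟩ := hcyc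
  have hg := cyc_gir hgir hm hinj hgm hiso hcon
  have hc : ∀ i < m, (chain F g m).Adj (g i) (g (i+1)) := fun i hi =>
    Or.inr ⟨(hadj i hi).ne, i, hi, Or.inl ⟨rfl, rfl⟩⟩
  have hcase : ∀ i < m, ∀ a < m, ∀ b < m, g a ≠ g b → (chain F g m).Adj (g i) (g a) →
      (chain F g m).Adj (g i) (g b) → ∀ w, ∃ w', w' ≠ w ∧ (chain F g m).Adj (g i) w' := by
    intro i _ a _ b _ hab h1 h2 w
    by_cases h : g a = w
    · exact ⟨g b, fun h' => hab (h.trans h'.symm), h2⟩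
    · exact ⟨g a, h, h1⟩
  have heq := hmax _ (chain_le F g m) (by
    rintro u v (h | ⟨-, i, hi, ⟨rfl, rfl⟩ | ⟨rfl, rfl⟩⟩)
    · exact hFG h
    · exact hadj i hi
    · exact (hadj i hi).symm) hg (chain_noLeaf hnl (by
      intro i hi w _
      have aux : ∀ i < m, ∃ w', w' ≠ w ∧ (chain F g m).Adj (g i) w' := by
        intro i hi
        rcases Nat.eq_zero_or_pos i with rfl | h0
        · refine hcase 0 hi 1 (by omega) (m-1) (by omega) (fun h => ?_) (hc 0 hi) ?_ w
          · have := hinj _ (by omega) _ (by omega) h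
            omega
          · have := hc (m-1) (by omega)
            rw [Nat.sub_add_cancel (by omega), hgm] at this
            exact this.symm
        · obtain ⟨j, rfl⟩ : ∃ j, i = j + 1 := ⟨i - 1, by omega⟩
          by_cases hj : j + 2 = m
          · refine hcase (j+1) hi j (by omega) 0 (by omega) (fun h => ?_) (hc j (by omega)).symm ?_ w
            · have := hinj _ (by omega) _ (by omega) h
              omega
            · have := hc (j+1) (by omega)
              rwa [show j + 1 + 1 = m from hj, hgm] at this
          · refine hcase (j+1) hi j (by omega) (j+2) (by omega) (fun h => ?_) (hc j (by omega)).symm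
              (hc (j+1) hi) w
            have := hinj _ (by omega) _ (by omega) h
            omega
      rcases Nat.lt_or_ge i m with h | h
      · exact aux i h
      · have : i = m := le_antisymm hi h
        subst this
        rw [hgm]
        exact aux 0 (by omega)))
  apply hiso 0 (by omega)
  rw [← heq]
  exact ⟨_, hc 0 (by omega)⟩

/-- Every cycle of a graph satisfying the girth condition is long. -/
lemma Gir.isCyc {F : SimpleGraph V} {ℓ m : ℕ} {g : ℕ → V} (h : Gir F ℓ) (hc : IsCyc F m g) :
    ℓ ≤ m := by
  obtain ⟨hm, hinj, hadj, hgm⟩ := hc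
  have hlast : F.Adj (g 0) (g (m-1)) := by
    have := hadj (m-1) (by omega)
    rw [Nat.sub_add_cancel (by omega), hgm] at this
    exact this.symm
  have key : ∀ k, k < m → ∃ p : (F.deleteEdges {s(g 0, g (m-1))}).Walk (g 0) (g k), p.length = k := by
    intro k
    induction k with
    | zero => intro _; exact ⟨Walk.nil, rfl⟩
    | succ k ih =>
      intro hk
      obtain ⟨p, hp⟩ := ih (by omega)
      refine ⟨p.concat (deleteEdges_adj.2 ⟨hadj k (by omega), ?_⟩), by simp [hp]⟩
      intro he
      rcases Sym2.eq_iff.1 (Set.mem_singleton_iff.1 he) with ⟨h1, h2⟩ | ⟨h1, h2⟩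
      · have := hinj _ (by omega) _ (by omega) h1
        have := hinj _ (by omega) _ (by omega) h2
        omega
      · have := hinj _ (by omega) _ (by omega) h2
        omega
  obtain ⟨p, hp⟩ := key (m-1) (by omega)
  have := h _ _ hlast p
  omega

lemma max_path {F G : SimpleGraph V} {ℓ : ℕ} (hFG : F ≤ G) (hgir : Gir F ℓ) (hnl : NoLeaf F)
    (hmax : ∀ F', F ≤ F' → F' ≤ G → Gir F' ℓ → NoLeaf F' → F' = F)
    {x y z z' : V} (hxy : x ≠ y) (hx : x ∈ F.support) (hy : y ∈ F.support)
    (hz : z ∉ F.support) (hxz : G.Adj x z) (hzy : G.Adj z' y)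
    (hr : (restr G F.supportᶜ).Reachable z z') : ∃ p : F.Walk x y, p.length < ℓ := by
  classical
  obtain ⟨q0⟩ := hr
  obtain ⟨q, hq⟩ := q0.toPath
  have hsup : ∀ v ∈ q.support, v ∈ (F.supportᶜ : Set V) := restr_support q hz
  obtain ⟨g, hg⟩ : ∃ g : ℕ → V, ∀ i, g i = if i = 0 then x else if i ≤ q.length + 1 then
    q.getVert (i - 1) else y := ⟨_, fun _ => rfl⟩
  have g0 : g 0 = x := by rw [hg]; simp
  have gl : g (q.length + 2) = y := by rw [hg]; simp
  have gm : ∀ i ≤ q.length, g (i+1) = q.getVert i := by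
    intro i hi; rw [hg]; simp [hi]
  have gsup : ∀ i ≤ q.length, g (i+1) ∉ F.support := by
    intro i hi; rw [gm i hi]; exact hsup _ (q.getVert_mem_support i)
  have hinj : ∀ i ≤ q.length + 2, ∀ j ≤ q.length + 2, i < j → g i ≠ g j := by
    intro i hi j hj hij he
    obtain ⟨j, rfl⟩ : ∃ j', j = j' + 1 := ⟨j - 1, by omega⟩
    rcases Nat.eq_zero_or_pos i with rfl | hi0
    · by_cases hjl : j = q.length + 1
      · subst hjl; rw [g0, gl] at he; exact hxy he
      · apply gsup j (by omega); rw [← he, g0]; exact hx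
    · obtain ⟨i, rfl⟩ : ∃ j', i = j' + 1 := ⟨i - 1, by omega⟩
      by_cases hjl : j = q.length + 1
      · subst hjl; apply gsup i (by omega); rw [he, gl]; exact hy
      · rw [gm i (by omega), gm j (by omega)] at he
        have := hq.getVert_injOn (by simp; omega) (by simp; omega) he
        omega
  have hmain := max_ear hFG hgir hnl hmax (g := g) (n := q.length + 2) (by omega) (by
    intro i hi j hj he
    rcases lt_trichotomy i j with h | h | h
    · exact absurd he (hinj i hi j hj h)
    · exact h
    · exact absurd he.symm (hinj j hj i hi h)) (by
    intro i hi
    rcases Nat.eq_zero_or_pos i with rfl | hi0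
    · rw [g0, gm 0 (by omega), Walk.getVert_zero]; exact hxz
    · obtain ⟨i, rfl⟩ : ∃ j', i = j' + 1 := ⟨i - 1, by omega⟩
      rw [gm i (by omega)]
      by_cases hil : i = q.length
      · subst hil; rw [gl, Walk.getVert_length]; exact hzy
      · rw [gm (i+1) (by omega)]
        exact restr_le _ _ (q.adj_getVert_succ (by omega))) (by
    intro i hi h0
    obtain ⟨i, rfl⟩ : ∃ j', i = j' + 1 := ⟨i - 1, by omega⟩
    exact gsup i (by omega)) (by rw [g0]; exact hx) (by rw [gl]; exact hy) (by
    intro h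
    exact gsup 0 (by omega) ⟨_, h.symm⟩)
  obtain ⟨p, hp⟩ := hmain
  exact ⟨p.copy g0 gl, by simpa using hp⟩

lemma max_edge {F G : SimpleGraph V} {ℓ : ℕ} (hℓ : 3 ≤ ℓ) (hFG : F ≤ G) (hgir : Gir F ℓ) (hnl : NoLeaf F)
    (hmax : ∀ F', F ≤ F' → F' ≤ G → Gir F' ℓ → NoLeaf F' → F' = F)
    {x y : V} (hx : x ∈ F.support) (hy : y ∈ F.support)
    (hxy : G.Adj x y) : ∃ p : F.Walk x y, p.length < ℓ := by
  by_cases hF : F.Adj x y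
  · exact ⟨hF.toWalk, by simp; omega⟩
  · obtain ⟨p, hp⟩ := max_ear hFG hgir hnl hmax (g := fun i => if i = 0 then x else y) (n := 1) le_rfl (by
      intro i hi j hj he
      have := hxy.ne
      have := hxy.ne'
      interval_cases i <;> interval_cases j <;> simp_all) (by
      intro i hi
      obtain rfl : i = 0 := by omega
      simpa using hxy) (by intro i hi h0; omega) (by simpa using hx) (by simpa using hy) (by simpa using hF)
    exact ⟨p, hp⟩

/-- Short walks from a deep vertex of an unbranched segment stay on the cycle. -/
lemma cyc_walk {F : SimpleGraph V} {c : ℕ → V} {m : ℕ} (sp : ℕ → Prop)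
    (h0 : sp 0) (hm : sp m)
    (hns : ∀ p, p + 1 < m → ¬ sp (p+1) → ∀ w, F.Adj (c (p+1)) w → w = c p ∨ w = c (p+2))
    {u v : V} (w : F.Walk u v) : ∀ i ≤ m, u = c i →
      (∀ p ≤ m, sp p → p + w.length ≤ i ∨ i + w.length ≤ p) →
      ∃ j ≤ m, v = c j ∧ i ≤ j + w.length ∧ j ≤ i + w.length := by
  induction w with
  | nil => intro i hi hu _; exact ⟨i, hi, hu, by simp, by simp⟩
  | cons hab w ih =>
    rintro i hi rfl hsp
    rw [Walk.length_cons] at *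
    have e0 := hsp 0 (by omega) h0
    have e1 := hsp m le_rfl hm
    have hn : ¬ sp i := fun h => by have := hsp i hi h; omega
    have hi0 : i ≠ 0 := by rintro rfl; exact hn h0
    have him : i ≠ m := by rintro rfl; exact hn hm
    obtain ⟨k, rfl⟩ : ∃ k, i = k + 1 := ⟨i - 1, by omega⟩
    rcases hns k (by omega) hn _ hab with h | h
    · obtain ⟨j, h1, h2, h3, h4⟩ := ih k (by omega) h (fun p hp h => by
        have := hsp p hp h; omega)
      exact ⟨j, h1, h2, by omega, by omega⟩
    · obtain ⟨j, h1, h2, h3, h4⟩ := ih (k+2) (by omega) h (fun p hp h => by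
        have := hsp p hp h; omega)
      exact ⟨j, h1, h2, by omega, by omega⟩

open Classical in
/-- The core decomposition step around a cycle with few special positions. -/
lemma core [Fintype V] {F G : SimpleGraph V} {ℓ : ℕ} (hℓ : 3 ≤ ℓ) (hFG : F ≤ G) (hgir : Gir F ℓ)
    (hnl : NoLeaf F)
    (hmax : ∀ F', F ≤ F' → F' ≤ G → Gir F' ℓ → NoLeaf F' → F' = F)
    {m : ℕ} {c : ℕ → V} (hc : IsCyc F m c) (sp : ℕ → Prop)
    (h0 : sp 0) (hm : sp m)
    (hns : ∀ p, p + 1 < m → ¬ sp (p+1) → ∀ w, F.Adj (c (p+1)) w → w = c p ∨ w = c (p+2)) :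
    ∃ S : Finset V, (∀ i < m, c i ∉ S) ∧ ∀ w, TD G w S ∅ →
      TD G (max w (2*ℓ+1) + ((Finset.range (m+1)).filter sp).card * (2*ℓ+1)) Finset.univ ∅ := by
  obtain ⟨hm3, hinj, hadj, hgm⟩ := hc
  obtain ⟨good, hgood⟩ : ∃ good : ℕ → Prop, ∀ i, good i ↔ i < m ∧ ∀ p ≤ m, sp p →
    p + ℓ < i ∨ i + ℓ < p := ⟨_, fun _ => Iff.rfl⟩
  obtain ⟨Rch, hRch⟩ : ∃ R : V → V → Prop, ∀ u v, R u v ↔ (restr G F.supportᶜ).Reachable u v :=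
    ⟨_, fun _ _ => Iff.rfl⟩
  obtain ⟨att, hatt⟩ : ∃ att : V → ℕ → Prop, ∀ z j, att z j ↔ z ∉ F.support ∧ good j ∧
    ∃ z1, Rch z z1 ∧ G.Adj z1 (c j) := ⟨_, fun _ _ => Iff.rfl⟩
  have csup : ∀ i ≤ m, c i ∈ F.support := by
    intro i hi
    rcases Nat.lt_or_ge i m with h | h
    · exact ⟨_, hadj i h⟩
    · obtain rfl : i = m := le_antisymm hi h
      rw [hgm]; exact ⟨_, hadj 0 (by omega)⟩
  have gm : ∀ i, good i → i < m := fun i h => ((hgood i).1 h).1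
  -- short walks from good positions
  have hwalk : ∀ i, good i → ∀ v, (∃ p : F.Walk (c i) v, p.length < ℓ) →
      ∃ j < m, v = c j ∧ i < j + ℓ ∧ j < i + ℓ := by
    rintro i hi v ⟨p, hp⟩
    have hi' := ((hgood i).1 hi)
    obtain ⟨j, h1, h2, h3, h4⟩ := cyc_walk sp h0 hm hns p i (by omega) rfl (fun q hq hs => by
      have := hi'.2 q hq hs; omega)
    have := hi'.2 m le_rfl hm
    exact ⟨j, by omega, h2, by omega, by omega⟩
  have hedge : ∀ i, good i → ∀ v, v ∈ F.support → G.Adj (c i) v →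
      ∃ j < m, v = c j ∧ i < j + ℓ ∧ j < i + ℓ := by
    intro i hi v hv hadj
    exact hwalk i hi v (max_edge hℓ hFG hgir hnl hmax (csup i (gm i hi).le) hv hadj)
  have hpath : ∀ z i, att z i → ∀ v, v ∈ F.support → ∀ z1, Rch z z1 → G.Adj z1 v →
      ∃ j < m, v = c j ∧ i < j + ℓ ∧ j < i + ℓ := by
    intro z i hzi v hv z1 hz1 hadj1
    obtain ⟨hz, hi, z2, hz2, hadj2⟩ := (hatt z i).1 hzi
    by_cases hiv : c i = v
    · exact ⟨i, gm i hi, hiv.symm, by omega, by omega⟩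
    · rw [hRch] at hz1 hz2
      obtain ⟨q⟩ := hz2
      have hz2' : z2 ∉ F.support := restr_support q hz _ q.end_mem_support
      exact hwalk i hi v (max_path hFG hgir hnl hmax hiv (csup i (gm i hi).le) hv hz2' hadj2.symm hadj1
        ((q.reachable).symm.trans hz1))
  have hstep : ∀ u v j, u ∉ F.support → v ∉ F.support → G.Adj u v → att u j → att v j := by
    intro u v j hu hv huv h
    obtain ⟨-, hi, z2, hz2, hadj2⟩ := (hatt u j).1 h
    refine (hatt v j).2 ⟨hv, hi, z2, ?_, hadj2⟩
    rw [hRch] at hz2 ⊢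
    exact (Adj.reachable (show (restr G F.supportᶜ).Adj v u from ⟨huv.symm, hv, hu⟩)).trans hz2
  have hself : ∀ z, Rch z z := fun z => (hRch z z).2 (Reachable.refl _)
  obtain ⟨τ, hτ⟩ : ∃ τ : V → ℕ, ∀ v, τ v = sInf {j | (good j ∧ v = c j) ∨ att v j} := ⟨_, fun _ => rfl⟩
  have τc : ∀ i, good i → τ (c i) = i := by
    intro i hi
    have : {j | (good j ∧ c i = c j) ∨ att (c i) j} = {i} := by
      ext j
      simp only [Set.mem_setOf_eq, Set.mem_singleton_iff]
      constructor
      · rintro (⟨h1, h2⟩ | h)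
        · exact (hinj _ (gm i hi) _ (gm j h1) h2).symm
        · exact absurd (csup i (gm i hi).le) ((hatt _ _).1 h).1
      · rintro rfl
        exact Or.inl ⟨hi, rfl⟩
    rw [hτ, this, csInf_singleton]
  have τd : ∀ z, z ∉ F.support → τ z = sInf {j | att z j} := by
    intro z hz
    rw [hτ]
    congr 1
    ext j
    simp only [Set.mem_setOf_eq]
    constructor
    · rintro (⟨h1, rfl⟩ | h)
      · exact absurd (csup j (gm j h1).le) hz
      · exact h
    · exact Or.inr
  have τatt : ∀ z, (∃ j, att z j) → att z (τ z) := by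
    rintro z ⟨j, hj⟩
    rw [τd z ((hatt _ _).1 hj).1]
    exact Nat.sInf_mem ⟨j, hj⟩
  obtain ⟨C, hC⟩ : ∃ C : Finset V, ∀ v, v ∈ C ↔ ∃ i, good i ∧ v = c i :=
    ⟨Finset.univ.filter (fun v => ∃ i, good i ∧ v = c i), by simp⟩
  obtain ⟨D, hD⟩ : ∃ D : Finset V, ∀ v, v ∈ D ↔ ∃ j, att v j :=
    ⟨Finset.univ.filter (fun v => ∃ j, att v j), by simp⟩
  have Dsup : ∀ v ∈ D, v ∉ F.support := by
    intro v hv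
    obtain ⟨j, hj⟩ := (hD v).1 hv
    exact ((hatt _ _).1 hj).1
  have hZ : TD G (ℓ + 1 + ℓ) (D ∪ C) ∅ := by
    apply layer_TD (by omega) D C τ
    · intro v hv hvC
      obtain ⟨i, hi, rfl⟩ := (hC _).1 hvC
      exact Dsup _ hv (csup i (gm i hi).le)
    · intro u hu v hv huv
      obtain ⟨i, hi, rfl⟩ := (hC _).1 hu
      obtain ⟨j, hj, rfl⟩ := (hC _).1 hv
      rw [τc i hi, τc j hj] at huv
      rw [huv]
    · intro u hu v hv huv
      rw [τd u (Dsup u hu), τd v (Dsup v hv)]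
      congr 1
      ext j
      exact ⟨hstep u v j (Dsup u hu) (Dsup v hv) huv, hstep v u j (Dsup v hv) (Dsup u hu) huv.symm⟩
    · intro u hu v hv huv
      obtain ⟨j, hj, rfl⟩ := (hC _).1 hv
      rw [τc j hj]
      have h1 := τatt u ((hD u).1 hu)
      refine ⟨?_, ?_⟩
      · rw [τd u (Dsup u hu)]
        exact Nat.sInf_le ((hatt _ _).2 ⟨Dsup u hu, hj, u, hself u, huv⟩)
      · obtain ⟨j', h2, h3, h4, h5⟩ := hpath u _ h1 (c j) (csup j (gm j hj).le) u (hself u) huv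
        have := hinj _ (gm j hj) _ h2 h3
        omega
    · intro u hu v hv huv
      obtain ⟨i, hi, rfl⟩ := (hC _).1 hu
      obtain ⟨j, hj, rfl⟩ := (hC _).1 hv
      rw [τc i hi, τc j hj]
      obtain ⟨j', h2, h3, h4, h5⟩ := hedge i hi (c j) (csup j (gm j hj).le) huv
      have := hinj _ (gm j hj) _ h2 h3
      omega
    · intro i
      apply NoLong.TD (by omega)
      intro m' g hg hgU
      refine max_cyc hFG hgir hnl hmax hg (fun i hi => ?_)
      exact Dsup _ (Finset.mem_filter.1 (hgU i hi)).1
  obtain ⟨X, hX⟩ : ∃ X : Finset V, ∀ v, v ∈ X ↔ ∃ i < m, ¬ good i ∧ v = c i :=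
    ⟨Finset.univ.filter (fun v => ∃ i < m, ¬ good i ∧ v = c i), by simp⟩
  have hXC : ∀ i < m, c i ∈ X ∨ c i ∈ C := by
    intro i hi
    by_cases h : good i
    · exact Or.inr ((hC _).2 ⟨i, h, rfl⟩)
    · exact Or.inl ((hX _).2 ⟨i, hi, h, rfl⟩)
  have hXcard : X.card ≤ ((Finset.range (m+1)).filter sp).card * (2*ℓ+1) := by
    have hsub : X ⊆ ((Finset.range (m+1)).filter sp).biUnion
        (fun p => (Finset.Icc (p - ℓ) (p + ℓ)).image c) := by
      intro v hv
      obtain ⟨i, hi, hb, rfl⟩ := (hX v).1 hv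
      rw [hgood] at hb
      push Not at hb
      obtain ⟨p, hp, hsp, h1, h2⟩ := hb hi
      simp only [Finset.mem_biUnion, Finset.mem_filter, Finset.mem_range, Finset.mem_image, Finset.mem_Icc]
      exact ⟨p, ⟨by omega, hsp⟩, i, ⟨by omega, by omega⟩, rfl⟩
    refine (Finset.card_le_card hsub).trans (Finset.card_biUnion_le_card_mul _ _ _ ?_)
    intro p _
    refine Finset.card_image_le.trans ?_
    simp
    omega
  refine ⟨Finset.univ \ (X ∪ (D ∪ C)), ?_, ?_⟩
  · intro i hi h
    simp only [Finset.mem_sdiff, Finset.mem_univ, true_and, Finset.mem_union] at h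
    have := hXC i hi
    tauto
  · intro w hw
    have hg := TD.glue (hZ.mono (show ℓ + 1 + ℓ ≤ max w (2*ℓ+1) by omega)) (hw.mono (le_max_left w (2*ℓ+1)))
      (by
        intro v h1 h2
        simp only [Finset.mem_sdiff, Finset.mem_univ, true_and, Finset.mem_union] at h1 h2
        tauto) (by
        intro u v hu _ hv _ huv
        have hvX : v ∉ X := fun h => by simp [h] at hv
        have hvD : v ∉ D := fun h => by simp [h] at hv
        have hvC : v ∉ C := fun h => by simp [h] at hv
        have hfin : ¬ ∃ j < m, v = c j := by
          rintro ⟨j, hj, rfl⟩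
          rcases hXC j hj with h | h
          · exact hvX h
          · exact hvC h
        rcases Finset.mem_union.1 hu with hu | hu
        · have h1 := τatt u ((hD u).1 hu)
          by_cases hvs : v ∈ F.support
          · obtain ⟨j, hj, h, -⟩ := hpath u _ h1 v hvs u (hself u) huv
            exact hfin ⟨j, hj, h⟩
          · exact hvD ((hD v).2 ⟨_, hstep u v _ (Dsup u hu) hvs huv h1⟩)
        · obtain ⟨i, hi, rfl⟩ := (hC u).1 hu
          by_cases hvs : v ∈ F.support
          · obtain ⟨j, hj, h, -⟩ := hedge i hi v hvs huv
            exact hfin ⟨j, hj, h⟩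
          · exact hvD ((hD v).2 ⟨i, (hatt _ _).2 ⟨hvs, hi, v, hself v, huv.symm⟩⟩))
    have h2 := (hg.addBag X).reroot (B' := ∅) (by simp)
    have h3 : (D ∪ C ∪ (Finset.univ \ (X ∪ (D ∪ C)))) ∪ X = Finset.univ := by
      ext v
      simp only [Finset.mem_sdiff, Finset.mem_univ, true_and, Finset.mem_union, iff_true]
      tauto
    rw [h3] at h2
    exact h2.mono (by omega)

open Classical in
lemma two_nbrs [Fintype V] {F : SimpleGraph V} {x a b w : V} (hd : dg F Finset.univ x < 3)
    (ha : F.Adj x a) (hb : F.Adj x b) (hab : a ≠ b) (hw : F.Adj x w) : w = a ∨ w = b := by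
  by_contra h
  push Not at h
  have : ({w, a, b} : Finset V) ⊆ Finset.univ.filter (fun w => F.Adj x w) := by
    intro z hz
    simp only [Finset.mem_insert, Finset.mem_singleton] at hz
    simp only [Finset.mem_filter, Finset.mem_univ, true_and]
    rcases hz with rfl | rfl | rfl <;> assumption
  have h1 := Finset.card_le_card this
  rw [Finset.card_eq_three.2 ⟨w, a, b, h.1, h.2, hab, rfl⟩] at h1
  unfold dg at hd
  omega

open Classical in
lemma step [Fintype V] (G : SimpleGraph V) {ℓ r ρ : ℕ} (hℓ : 3 ≤ ℓ) (hρ : 4*r ≤ 2^ρ) :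
    (∃ (m : Fin r → ℕ) (g : Fin r → ℕ → V), (∀ i, IsCyc G (m i) (g i) ∧ ℓ ≤ m i) ∧
      ∀ i j, i ≠ j → ∀ a < m i, ∀ b < m j, g i a ≠ g j b) ∨
    (∃ (m : ℕ) (c : ℕ → V) (S : Finset V), IsCyc G m c ∧ ℓ ≤ m ∧ (∀ i < m, c i ∉ S) ∧
      ∀ w, TD G w S ∅ → TD G (max w (2*ℓ+1) + (8*ρ+6)*(2*ℓ+1)) Finset.univ ∅) ∨
    TD G (ℓ+1) Finset.univ ∅ := by
  obtain ⟨F, hFG, hgir, hnl, hmax⟩ := exists_max G ℓ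
  by_cases hedge : ∃ u v, F.Adj u v
  · rcases star hρ F hnl hedge with ⟨C, hC, hdis⟩ | ⟨A, hA, hcard⟩
    · left
      choose m g hg using fun i => (hC i).isCyc
      refine ⟨m, g, fun i => ⟨(hg i).1.mono hFG, hgir.isCyc (hg i).1⟩, ?_⟩
      intro i j hij a ha b hb h
      exact Finset.disjoint_left.1 (hdis i j hij) ((hg i).2 a ha) (h ▸ (hg j).2 b hb)
    · right; left
      obtain ⟨m, c, hc, hcA⟩ := hA.isCyc
      obtain ⟨S, hS, hTD⟩ := core hℓ hFG hgir hnl hmax hc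
        (fun p => p = 0 ∨ p = m ∨ 3 ≤ dg F Finset.univ (c p)) (Or.inl rfl) (Or.inr (Or.inl rfl)) (by
          intro p hp hns w hw
          push Not at hns
          refine two_nbrs (by omega) (hc.2.2.1 p (by omega)).symm (hc.2.2.1 (p+1) hp) ?_ hw
          intro he
          by_cases hpm : p + 2 = m
          · have e := hc.2.2.2
            rw [← hpm] at e
            have e2 : c p = c 0 := he.trans e
            have := hc.2.1 p (by omega) 0 (by omega) e2
            have := hc.1
            omega
          · have := hc.2.1 p (by omega) (p+1+1) (by omega) he
            omega)
      refine ⟨m, c, S, hc.mono hFG, hgir.isCyc hc, hS, ?_⟩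
      intro w hw
      refine (hTD w hw).mono ?_
      have hcnt : ((Finset.range (m+1)).filter
          (fun p => p = 0 ∨ p = m ∨ 3 ≤ dg F Finset.univ (c p))).card ≤ 8*ρ+6 := by
        have hsub : (Finset.range (m+1)).filter (fun p => p = 0 ∨ p = m ∨ 3 ≤ dg F Finset.univ (c p)) ⊆
            insert 0 (insert m ((Finset.range m).filter (fun p => 3 ≤ dg F Finset.univ (c p)))) := by
          intro p hp
          simp only [Finset.mem_filter, Finset.mem_range, Finset.mem_insert] at hp ⊢
          omega
        refine (Finset.card_le_card hsub).trans ?_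
        refine (Finset.card_insert_le _ _).trans ?_
        have h1 := Finset.card_insert_le m ((Finset.range m).filter (fun p => 3 ≤ dg F Finset.univ (c p)))
        have h2 : ((Finset.range m).filter (fun p => 3 ≤ dg F Finset.univ (c p))).card ≤
            (A.filter (fun v => 3 ≤ dg F Finset.univ v)).card := by
          apply Finset.card_le_card_of_injOn c
          · intro p hp
            simp only [Finset.coe_filter, Finset.mem_range] at hp
            have hp' : p < m ∧ 3 ≤ dg F Finset.univ (c p) := hp
            exact Finset.mem_coe.2 (Finset.mem_filter.2 ⟨hcA p hp'.1, hp'.2⟩)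
          · intro p hp q hq h
            have hp' := Finset.mem_filter.1 (Finset.mem_coe.1 hp)
            have hq' := Finset.mem_filter.1 (Finset.mem_coe.1 hq)
            exact hc.2.1 p (Finset.mem_range.1 hp'.1) q (Finset.mem_range.1 hq'.1) h
        omega
      have := Nat.mul_le_mul_right (2*ℓ+1) hcnt
      convert Nat.add_le_add_left this _
  · right; right
    apply NoLong.TD (by omega)
    intro m g hg _
    refine max_cyc hFG hgir hnl hmax hg (fun i _ => ?_)
    rintro ⟨w, hw⟩
    exact hedge ⟨_, _, hw⟩

open Classical in
lemma main_ind [Fintype V] {r ρ : ℕ} (hρ : 4*r ≤ 2^ρ) (a : Fin r → ℕ) (ha : ∀ i, 3 ≤ a i) (n : ℕ) :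
    ∀ (I : Finset (Fin r)) (_ : I.card = n) (G : SimpleGraph V),
    TD G (∑ i ∈ I, (24*ρ+21) * a i) Finset.univ ∅ ∨
    ∃ (m : Fin r → ℕ) (g : Fin r → ℕ → V), (∀ i ∈ I, IsCyc G (m i) (g i) ∧ a i ≤ m i) ∧
      ∀ i ∈ I, ∀ j ∈ I, i ≠ j → ∀ x < m i, ∀ y < m j, g i x ≠ g j y := by
  induction n with
  | zero =>
    intro I hI G
    have : I = ∅ := by simpa using hI
    subst this
    by_cases hV : Nonempty V
    · right
      exact ⟨fun _ => 0, fun _ _ => hV.some, by simp, by simp⟩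
    · left
      have hE : (Finset.univ : Finset V) = ∅ := Finset.univ_eq_empty_iff.2 (not_nonempty_iff.1 hV)
      rw [hE]
      exact TD.single G (by simp)
  | succ n ih =>
    intro I hI G
    have hne : I.Nonempty := Finset.card_pos.1 (by omega)
    obtain ⟨i0, hi0, hmaxa⟩ := Finset.exists_max_image I a hne
    have hsum : ∑ i ∈ I, (24*ρ+21) * a i = ∑ i ∈ I.erase i0, (24*ρ+21) * a i + (24*ρ+21) * a i0 :=
      (Finset.sum_erase_add I _ hi0).symm
    have hbig : a i0 + 1 ≤ (24*ρ+21) * a i0 := by nlinarith [ha i0]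
    rcases step G (ha i0) hρ with ⟨m, g, h1, h2⟩ | ⟨m, c, S, hc, hm, hS, hTD⟩ | h
    · right
      exact ⟨m, g, fun i hi => ⟨(h1 i).1, (hmaxa i hi).trans (h1 i).2⟩, fun i _ j _ hij => h2 i j hij⟩
    · rcases ih (I.erase i0) (by rw [Finset.card_erase_of_mem hi0]; omega) (restr G (S : Set V)) with h | ⟨m', g', h1, h2⟩
      · left
        have h3 := h.inter S
        rw [Finset.univ_inter, Finset.empty_inter] at h3
        have h4 : TD G _ S ∅ := h3.congr (fun u hu v hv huv => (⟨huv, hu, hv⟩ : (restr G (S : Set V)).Adj u v))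
        refine (hTD _ h4).mono ?_
        rw [hsum]
        have h5 : max (∑ i ∈ I.erase i0, (24*ρ+21) * a i) (2 * a i0 + 1) ≤
          ∑ i ∈ I.erase i0, (24*ρ+21) * a i + (2 * a i0 + 1) := by omega
        have h6 : (2 * a i0 + 1) + (8*ρ+6)*(2 * a i0 + 1) ≤ (24*ρ+21) * a i0 := by
          nlinarith [ha i0, Nat.mul_le_mul_left ρ (ha i0)]
        omega
      · right
        have hin : ∀ i ∈ I.erase i0, ∀ x < m' i, g' i x ∈ S := fun i hi x hx =>
          ((h1 i hi).1.2.2.1 x hx).2.1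
        refine ⟨Function.update m' i0 m, Function.update g' i0 c, ?_, ?_⟩
        · intro i hi
          by_cases h : i = i0
          · subst h; simp only [Function.update_self]; exact ⟨hc, hm⟩
          · simp only [Function.update_of_ne h]
            have := h1 i (Finset.mem_erase.2 ⟨h, hi⟩)
            exact ⟨this.1.mono (restr_le _ _), this.2⟩
        · intro i hi j hj hij
          by_cases h : i = i0
          · subst h
            simp only [Function.update_self, Function.update_of_ne hij.symm]
            intro x hx y hy he
            exact hS x hx (he ▸ hin j (Finset.mem_erase.2 ⟨hij.symm, hj⟩) y hy)
          · by_cases h' : j = i0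
            · subst h'
              simp only [Function.update_self, Function.update_of_ne hij]
              intro x hx y hy he
              exact hS y hy (he ▸ hin i (Finset.mem_erase.2 ⟨hij, hi⟩) x hx)
            · simp only [Function.update_of_ne h, Function.update_of_ne h']
              exact h2 i (Finset.mem_erase.2 ⟨h, hi⟩) j (Finset.mem_erase.2 ⟨h', hj⟩) hij
    · left
      exact h.mono (by rw [hsum]; omega)

lemma seg_connected {G : SimpleGraph V} (g : ℕ → V) (k e : ℕ) (hke : k ≤ e)
    (hadj : ∀ j, k ≤ j → j < e → G.Adj (g j) (g (j+1))) :
    (G.induce {v | ∃ j, k ≤ j ∧ j ≤ e ∧ v = g j}).Connected := by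
  have key : ∀ d, ∀ h : k + d ≤ e, (G.induce {v | ∃ j, k ≤ j ∧ j ≤ e ∧ v = g j}).Reachable
      ⟨g k, k, le_rfl, hke, rfl⟩ ⟨g (k+d), k+d, by omega, h, rfl⟩ := by
    intro d
    induction d with
    | zero => intro h; exact Reachable.refl _
    | succ d ih =>
      intro h
      refine (ih (by omega)).trans (Adj.reachable ?_)
      exact hadj (k+d) (by omega) (by omega)
  rw [connected_iff_exists_forall_reachable]
  refine ⟨⟨g k, k, le_rfl, hke, rfl⟩, ?_⟩
  rintro ⟨v, j, h1, h2, rfl⟩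
  obtain ⟨d, rfl⟩ := Nat.exists_eq_add_of_le h1
  exact key d h2

lemma edges_getVert {W : Type*} {H : SimpleGraph W} {u v : W} (p : H.Walk u v) {x y : W}
    (h : s(x,y) ∈ p.edges) : ∃ t < p.length, (x = p.getVert t ∧ y = p.getVert (t+1)) ∨
      (y = p.getVert t ∧ x = p.getVert (t+1)) := by
  induction p with
  | nil => simp at h
  | cons hab p ih =>
    rw [Walk.edges_cons, List.mem_cons] at h
    rcases h with h | h
    · refine ⟨0, by simp, ?_⟩
      rcases Sym2.eq_iff.1 h with ⟨rfl, rfl⟩ | ⟨rfl, rfl⟩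
      · left; simp
      · right; simp
    · obtain ⟨t, ht, h⟩ := ih h
      exact ⟨t+1, by simpa using ht, by simpa using h⟩

lemma minor_of_cycles {W : Type} {H : SimpleGraph W} {G : SimpleGraph V} {r : ℕ}
    (f : Fin r → Σ v, H.Walk v v) (hf : ∀ i, (f i).2.IsCycle)
    (hdis : ∀ i j, i ≠ j → ∀ x ∈ (f i).2.support, x ∉ (f j).2.support)
    (hcov : ∀ w : W, ∃ i, w ∈ (f i).2.support)
    (hedge : ∀ e ∈ H.edgeSet, ∃ i, e ∈ (f i).2.edges)
    (m : Fin r → ℕ) (g : Fin r → ℕ → V)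
    (hg : ∀ i, IsCyc G (m i) (g i) ∧ (f i).2.length ≤ m i)
    (hgd : ∀ i j, i ≠ j → ∀ x < m i, ∀ y < m j, g i x ≠ g j y) : IsMinor H G := by
  have hcyc := fun i => IsCyc.of_isCycle (hf i)
  have hidx : ∀ w : W, ∃ i, ∃ k < (f i).2.length, (f i).2.getVert k = w := by
    intro w
    obtain ⟨i, hi⟩ := hcov w
    obtain ⟨k, hk, hk'⟩ := Walk.mem_support_iff_exists_getVert.1 hi
    rcases Nat.lt_or_ge k (f i).2.length with h | h
    · exact ⟨i, k, h, hk⟩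
    · refine ⟨i, 0, by have := (hcyc i).1; omega, ?_⟩
      rw [← hk, ← (hcyc i).2.2.2]
      congr 1
      omega
  choose I k hk hkw using hidx
  have huniq : ∀ w i t, t < (f i).2.length → (f i).2.getVert t = w → I w = i ∧ k w = t := by
    intro w i t ht hw
    have hI : I w = i := by
      by_contra hne
      refine hdis _ _ hne w ?_ ?_
      · have := (f (I w)).2.getVert_mem_support (k w)
        rwa [hkw] at this
      · rw [← hw]; exact Walk.getVert_mem_support _ _
    refine ⟨hI, ?_⟩
    subst hI
    exact (hcyc (I w)).2.1 _ (hk w) _ ht ((hkw w).trans hw.symm)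
  obtain ⟨e, he⟩ : ∃ e : W → ℕ, ∀ w, e w = if k w + 1 = (f (I w)).2.length then m (I w) - 1 else k w :=
    ⟨_, fun _ => rfl⟩
  have hke : ∀ w, k w ≤ e w := by
    intro w
    have := (hg (I w)).2
    have := hk w
    rw [he]; split_ifs <;> omega
  have hem : ∀ w, e w < m (I w) := by
    intro w
    have := (hg (I w)).2
    have := hk w
    rw [he]; split_ifs <;> omega
  have hadj : ∀ w, ∀ j < m (I w), G.Adj (g (I w) j) (g (I w) (j+1)) := fun w => (hg (I w)).1.2.2.1
  refine ⟨fun w => {v | ∃ j, k w ≤ j ∧ j ≤ e w ∧ v = g (I w) j}, ?_, ?_, ?_⟩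
  · intro w
    refine ⟨⟨_, k w, le_rfl, hke w, rfl⟩, ?_⟩
    refine seg_connected _ _ _ (hke w) (fun j _ h2 => hadj w j ?_)
    have := hem w
    omega
  · intro w w' hne
    rw [Set.disjoint_left]
    rintro v ⟨j, h1, h2, rfl⟩ ⟨j', h1', h2', h⟩
    have a1 := hem w
    have a2 := hem w'
    by_cases hI : I w = I w'
    · have hkne : k w ≠ k w' := by
        intro h
        apply hne
        rw [← hkw w, ← hkw w', h, hI]
      rw [hI] at h a1
      have hjj := (hg (I w')).1.2.1 j (by omega) j' (by omega) h
      have b1 := he w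
      have b2 := he w'
      have b3 := hk w
      have b4 := hk w'
      rw [hI] at b1 b3
      split_ifs at b1 b2 <;> omega
    · exact hgd _ _ hI j (by omega) j' (by omega) h
  · have main : ∀ i, ∀ t < (f i).2.length, ∀ w w', w = (f i).2.getVert t → w' = (f i).2.getVert (t+1) →
        ∃ u, (∃ j, k w ≤ j ∧ j ≤ e w ∧ u = g (I w) j) ∧ ∃ v, (∃ j, k w' ≤ j ∧ j ≤ e w' ∧ v = g (I w') j) ∧
          G.Adj u v := by
      intro i t ht w w' hw hw'
      obtain ⟨h1, h2⟩ := huniq w i t ht hw.symm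
      have hm := (hg i).1.1
      rcases Nat.lt_or_ge (t+1) (f i).2.length with h | h
      · obtain ⟨h3, h4⟩ := huniq w' i (t+1) h hw'.symm
        refine ⟨g i t, ⟨t, h2.le, ?_, by rw [h1]⟩, g i (t+1), ⟨t+1, h4.le, ?_, by rw [h3]⟩, ?_⟩
        · rw [← h2]; exact hke w
        · rw [← h4]; exact hke w'
        · exact (hg i).1.2.2.1 t (by have := (hg i).2; omega)
      · have h5 : t + 1 = (f i).2.length := by omega
        have hw0 : w' = (f i).2.getVert 0 := by
          rw [hw', h5]; exact (hcyc i).2.2.2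
        obtain ⟨h3, h4⟩ := huniq w' i 0 (by omega) hw0.symm
        refine ⟨g i (m i - 1), ⟨m i - 1, ?_, ?_, by rw [h1]⟩, g i 0, ⟨0, h4.le, by omega, by rw [h3]⟩, ?_⟩
        · have := (hg i).2; omega
        · rw [he, h1, h2, if_pos h5]
        · have := (hg i).1.2.2.1 (m i - 1) (by omega)
          rwa [Nat.sub_add_cancel (by omega), (hg i).1.2.2.2] at this
    intro w w' hww
    obtain ⟨i, hi⟩ := hedge s(w,w') hww
    obtain ⟨t, ht, ⟨h1, h2⟩ | ⟨h1, h2⟩⟩ := edges_getVert _ hi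
    · exact main i t ht w w' h1 h2
    · obtain ⟨u, hu, v, hv, huv⟩ := main i t ht w' w h1 h2
      exact ⟨v, hv, u, hu, huv.symm⟩

lemma sum_length_le {W : Type} [Fintype W] {H : SimpleGraph W} {r : ℕ}
    (f : Fin r → Σ v, H.Walk v v) (hf : ∀ i, (f i).2.IsCycle)
    (hdis : ∀ i j, i ≠ j → ∀ x ∈ (f i).2.support, x ∉ (f j).2.support) :
    ∑ i, (f i).2.length ≤ Fintype.card W := by
  have hcyc := fun i => IsCyc.of_isCycle (hf i)
  have hc : Fintype.card (Σ i, Fin (f i).2.length) = ∑ i, (f i).2.length := by simp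
  rw [← hc]
  apply Fintype.card_le_of_injective (fun q : (Σ i, Fin (f i).2.length) => (f q.1).2.getVert q.2)
  rintro ⟨i, a⟩ ⟨j, b⟩ h
  have h' : (f i).2.getVert a = (f j).2.getVert b := h
  by_cases hij : i = j
  · subst hij
    have := (hcyc i).2.1 _ a.2 _ b.2 h'
    rw [Fin.ext this]
  · exact absurd (h' ▸ Walk.getVert_mem_support _ _) (hdis i j hij _ (Walk.getVert_mem_support _ a))

/-- Main theorem: for some absolute constant `c`, every graph of treewidth at least
`c·|V(H)|·log₂(r+1) + c·r·log₂ r·log₂ ℓ` contains `H`, the disjoint union of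
`r` cycles of length at most `ℓ`, as a minor. -/
theorem stmt_8 :
    ∃ c : ℝ, 0 < c ∧
      ∀ (W V : Type) (_ : Fintype W) (_ : Fintype V)
        (H : SimpleGraph W) (G : SimpleGraph V) (r ℓ : ℕ), 0 < r →
        IsDisjointUnionOfCycles H r ℓ →
        c * (Fintype.card W) * Real.logb 2 (r + 1)
            + c * r * Real.logb 2 r * Real.logb 2 ℓ ≤ (treewidth G : ℝ) →
        IsMinor H G := by
  refine ⟨200, by norm_num, ?_⟩
  intro W V _ _ H G r ℓ hr hH htw
  obtain ⟨f, hf, hdis, hcov, hedge⟩ := hH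
  have hcyc := fun i => IsCyc.of_isCycle (hf i).1
  have h3 : ∀ i, 3 ≤ (f i).2.length := fun i => (hcyc i).1
  have hρ : 4 * r ≤ 2 ^ (Nat.log 2 r + 3) := by
    have := Nat.lt_pow_succ_log_self (b := 2) (by norm_num) r
    rw [pow_add]
    rw [Nat.succ_eq_add_one, pow_add] at this
    omega
  rcases main_ind hρ (fun i => (f i).2.length) h3 _ Finset.univ rfl G with h | ⟨m, g, h1, h2⟩
  · exfalso
    set N := ∑ i, (f i).2.length with hN
    have hNW : N ≤ Fintype.card W := sum_length_le f (fun i => (hf i).1) hdis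
    have hN3 : 3 ≤ N := (h3 ⟨0, hr⟩).trans
      (Finset.single_le_sum (f := fun i => (f i).2.length) (fun _ _ => Nat.zero_le _) (Finset.mem_univ _))
    rw [← Finset.mul_sum, ← hN] at h
    have h' : TD G ((24 * (Nat.log 2 r + 3) + 21) * N - 1 + 1) Finset.univ ∅ := h.mono (by omega)
    have htw2 : treewidth G ≤ (24 * (Nat.log 2 r + 3) + 21) * N - 1 := Nat.sInf_le h'.hasTreeDecompWidth
    have hpos : 0 < (24 * (Nat.log 2 r + 3) + 21) * N := Nat.mul_pos (by omega) (by omega)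
    have htw3 : treewidth G < (24 * (Nat.log 2 r + 3) + 21) * Fintype.card W :=
      lt_of_lt_of_le (by omega) (Nat.mul_le_mul_left (24 * (Nat.log 2 r + 3) + 21) hNW)
    have hL1 : (1:ℝ) ≤ Real.logb 2 (r+1) := by
      rw [Real.le_logb_iff_rpow_le (by norm_num) (by positivity)]
      have : (1:ℝ) ≤ r := by exact_mod_cast hr
      norm_num; linarith
    have hL2 : (Nat.log 2 r : ℝ) ≤ Real.logb 2 (r+1) := by
      rw [Real.le_logb_iff_rpow_le (by norm_num) (by positivity), Real.rpow_natCast]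
      have : 2 ^ Nat.log 2 r ≤ r := Nat.pow_log_le_self 2 (by omega)
      have : (2:ℝ) ^ Nat.log 2 r ≤ r := by exact_mod_cast this
      linarith
    have hL3 : 0 ≤ Real.logb 2 (r:ℝ) := Real.logb_nonneg (by norm_num) (by exact_mod_cast hr)
    have hL4 : 0 ≤ Real.logb 2 (ℓ:ℝ) := by
      apply Real.logb_nonneg (by norm_num)
      have := (h3 ⟨0, hr⟩).trans (hf ⟨0, hr⟩).2
      exact_mod_cast (by omega : 1 ≤ ℓ)
    have hsec : 0 ≤ 200 * (r:ℝ) * Real.logb 2 r * Real.logb 2 ℓ := by positivity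
    have htw4 : (treewidth G : ℝ) < (24 * (Nat.log 2 r + 3) + 21) * Fintype.card W := by exact_mod_cast htw3
    have hWpos : (0:ℝ) ≤ Fintype.card W := by positivity
    have : ((24 * (Nat.log 2 r + 3) + 21 : ℝ)) * Fintype.card W ≤ (200 * Real.logb 2 (r+1)) * Fintype.card W := by
      apply mul_le_mul_of_nonneg_right _ hWpos
      linarith
    linarith
  · exact minor_of_cycles f (fun i => (hf i).1) hdis hcov hedge m g (fun i => h1 i (Finset.mem_univ _))
      (fun i j hij => h2 i (Finset.mem_univ _) j (Finset.mem_univ _) hij)
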